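/- arXiv:2107.04176 — 8 statements merged into one kernel-verified Lean document; each statement's English description precedes it below -/
import Mathlib

section
/- There exist constants δ* > 0 and C₁, C₂ > 0 such that for every δ ∈ (0, δ*) there exists a four-times differentiable function ū : (0, ∞) → ℝ with ū(x) < 0 and ū'(x) > 0 for all x > 0, lim_{x→0⁺} ū(x) = −δ, lim_{x→∞} ū(x) = 0, such that q̄ := −ū²/2 satisfies −q̄''(x) + q̄(x) + ū'(x) = 0 for all x > 0, and for all x > 0: C₁ δ/(1+δx) ≤ −ū(x) ≤ C₂ δ/(1+δx); C₁ δ²/(1+δx)² ≤ ū'(x) ≤ C₂ δ²/(1+δx)²; |ū^{(k)}(x)| ≤ C₂ δ^{k+1}/(1+δx)^{k+1} for k = 1, 2, 3, 4; |ū''(x)²/ū'(x)| ≤ C₂ δ⁴/(1+δx)⁴; |ū'''(x)²/ū'(x)| ≤ C₂ δ⁶/(1+δx)⁶; |ū'''(x)/ū'(x)| ≤ C₂ δ²/(1+δx)²; and |ū''''(x)/ū'(x)| ≤ C₂ δ³/(1+δx)³. -/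
open Set MeasureTheory Filter Topology

/-- A continuous bounded forcing `g` gives a bounded solution of `y' = 2 y + g` on the line. -/
theorem hasDerivAt_neg_exp_mul_integral_Ioi {g : ℝ → ℝ} (hg : Continuous g) {B : ℝ}
    (hB : ∀ t, |g t| ≤ B) (t : ℝ) :
    HasDerivAt (fun t => -(Real.exp (2 * t) * ∫ s in Ioi t, Real.exp (-2 * s) * g s))
      (2 * -(Real.exp (2 * t) * ∫ s in Ioi t, Real.exp (-2 * s) * g s) + g t) t := by
  have hcont : Continuous fun s => Real.exp (-2 * s) * g s := by fun_prop
  have hint : ∀ a, IntegrableOn (fun s => Real.exp (-2 * s) * g s) (Ioi a) := fun a => by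
    refine Integrable.mono' ((integrableOn_exp_mul_Ioi (by norm_num : (-2 : ℝ) < 0) a).mul_const B)
      hcont.aestronglyMeasurable (ae_of_all _ fun s => ?_)
    rw [Real.norm_eq_abs, abs_mul, abs_of_pos (Real.exp_pos _)]
    exact mul_le_mul_of_nonneg_left (hB s) (Real.exp_pos _).le
  have hsplit : ∀ a, ∫ s in Ioi a, Real.exp (-2 * s) * g s
      = (∫ s in Ioi 0, Real.exp (-2 * s) * g s) - ∫ s in (0 : ℝ)..a, Real.exp (-2 * s) * g s :=
    fun a => by
      rw [← intervalIntegral.integral_interval_add_Ioi (hint 0) (hint a)]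
      ring
  have hI : HasDerivAt (fun a => ∫ s in Ioi a, Real.exp (-2 * s) * g s)
      (-(Real.exp (-2 * t) * g t)) t := by
    rw [funext hsplit]
    exact (intervalIntegral.integral_hasDerivAt_right (hcont.intervalIntegrable _ _)
      (hcont.stronglyMeasurableAtFilter _ _) hcont.continuousAt).const_sub _
  have hE : HasDerivAt (fun t : ℝ => Real.exp (2 * t)) (Real.exp (2 * t) * 2) t := by
    simpa using ((hasDerivAt_id t).const_mul 2).exp
  refine (hE.mul hI).neg.congr_deriv ?_
  have : Real.exp (2 * t) * Real.exp (-2 * t) = 1 := by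
    rw [← Real.exp_add]; simp
  linear_combination g t * this

theorem abs_neg_exp_mul_integral_Ioi_le {g : ℝ → ℝ} {B : ℝ} (hB : ∀ t, |g t| ≤ B) (t : ℝ) :
    |-(Real.exp (2 * t) * ∫ s in Ioi t, Real.exp (-2 * s) * g s)| ≤ B / 2 := by
  have h := norm_integral_le_of_norm_le (f := fun s => Real.exp (-2 * s) * g s)
    ((integrableOn_exp_mul_Ioi (by norm_num : (-2 : ℝ) < 0) t).mul_const B)
    (ae_of_all _ fun s => by
      rw [Real.norm_eq_abs, abs_mul, abs_of_pos (Real.exp_pos _)]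
      exact mul_le_mul_of_nonneg_left (hB s) (Real.exp_pos _).le)
  rw [integral_mul_const, integral_exp_mul_Ioi (by norm_num), Real.norm_eq_abs] at h
  rw [abs_neg, abs_mul, abs_of_pos (Real.exp_pos _)]
  refine (mul_le_mul_of_nonneg_left h (Real.exp_pos _).le).trans_eq ?_
  have : Real.exp (2 * t) * Real.exp (-2 * t) = 1 := by
    rw [← Real.exp_add]; simp
  linear_combination B / 2 * this

/-- Bounded solutions of `y' = 2 y + N t y` for a bounded nonlinearity with Lipschitz
constant one. -/
theorem exists_bounded_solution {N : ℝ → ℝ → ℝ} (hN : Continuous fun p : ℝ × ℝ => N p.1 p.2)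
    {B : ℝ} (hB : ∀ t y, |N t y| ≤ B) (hL : ∀ t y z, |N t y - N t z| ≤ |y - z|) :
    ∃ y : ℝ → ℝ, ∀ t, HasDerivAt y (2 * y t + N t (y t)) t ∧ |y t| ≤ B / 2 := by
  have hc : ∀ y : BoundedContinuousFunction ℝ ℝ, Continuous fun t => N t (y t) := fun y =>
    hN.comp (continuous_id.prodMk y.continuous)
  have hd := fun y : BoundedContinuousFunction ℝ ℝ =>
    hasDerivAt_neg_exp_mul_integral_Ioi (hc y) fun t => hB t (y t)
  have hb := fun y : BoundedContinuousFunction ℝ ℝ =>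
    abs_neg_exp_mul_integral_Ioi_le fun t => hB t (y t)
  let Φ : BoundedContinuousFunction ℝ ℝ → BoundedContinuousFunction ℝ ℝ := fun y =>
    BoundedContinuousFunction.ofNormedAddCommGroup _
      (continuous_iff_continuousAt.2 fun t => (hd y t).continuousAt) (B / 2) (hb y)
  have hint : ∀ (y : BoundedContinuousFunction ℝ ℝ) (a : ℝ),
      IntegrableOn (fun s => Real.exp (-2 * s) * N s (y s)) (Ioi a) := fun y a => by
    refine Integrable.mono' ((integrableOn_exp_mul_Ioi (by norm_num : (-2 : ℝ) < 0) a).mul_const B)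
      (Continuous.aestronglyMeasurable (by have := hc y; fun_prop)) (ae_of_all _ fun s => ?_)
    rw [Real.norm_eq_abs, abs_mul, abs_of_pos (Real.exp_pos _)]
    exact mul_le_mul_of_nonneg_left (hB _ _) (Real.exp_pos _).le
  have hΦ : ContractingWith (1 / 2 : NNReal) Φ := by
    refine ⟨by rw [← NNReal.coe_lt_coe]; norm_num, LipschitzWith.of_dist_le_mul fun y z => ?_⟩
    refine (BoundedContinuousFunction.dist_le (by positivity)).2 fun t => ?_
    have h := abs_neg_exp_mul_integral_Ioi_le (g := fun s => N s (y s) - N s (z s))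
      (B := dist y z) (fun s => (hL s _ _).trans (y.dist_coe_le_dist s)) t
    simp only [mul_sub] at h
    rw [integral_sub (hint y t) (hint z t)] at h
    rw [Real.dist_eq]
    convert h using 1
    · congr 1
      simp only [Φ, BoundedContinuousFunction.coe_ofNormedAddCommGroup]
      ring
    · push_cast; ring
  obtain ⟨y, hfix⟩ : ∃ y, Φ y = y := ⟨ContractingWith.fixedPoint Φ hΦ, hΦ.fixedPoint_isFixedPt⟩
  have hfun : (fun t => -(Real.exp (2 * t) * ∫ s in Ioi t, Real.exp (-2 * s) * N s (y s))) = y :=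
    congrArg DFunLike.coe hfix
  refine ⟨y, fun t => ?_⟩
  have hderiv := hd y t
  have hbound := hb y t
  rw [congrFun hfun t] at hbound hderiv
  rw [hfun] at hderiv
  exact ⟨hderiv, hbound⟩

/-- A bounded solution of a linear equation with unstable homogeneous part inherits the decay
of the forcing. -/
theorem abs_le_of_bounded_of_hasDerivAt {R a g : ℝ → ℝ} {T M G : ℝ} {n : ℕ} (hT : 0 ≤ T)
    (hG : 0 ≤ G)
    (hR : ∀ t, T < t → HasDerivAt R (a t * R t + g t) t) (ha : ∀ t, T < t → 1 ≤ a t)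
    (hM : ∀ t, T < t → |R t| ≤ M) (hg : ∀ t, T < t → |g t| ≤ G / t ^ n) {t : ℝ} (ht : T < t) :
    |R t| ≤ G / t ^ n := by
  have ht0 : 0 < t := hT.trans_lt ht
  set c := G / t ^ n with hc
  have hc0 : 0 ≤ c := by positivity
  by_contra! hlt
  have hd : 0 < R t ^ 2 - c ^ 2 := by
    rw [← sq_abs (R t)]; nlinarith
  set d := R t ^ 2 - c ^ 2 with hd_def
  have hF : ∀ s, T < s → HasDerivAt (fun s => (R s ^ 2 - c ^ 2) * Real.exp (-s))
      ((2 * R s * (a s * R s + g s) - (R s ^ 2 - c ^ 2)) * Real.exp (-s)) s := fun s hs => by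
    refine ((((hR s hs).pow 2).sub_const (c ^ 2)).mul (hasDerivAt_neg s).exp).congr_deriv ?_
    simp
    ring
  have hmono : MonotoneOn (fun s => (R s ^ 2 - c ^ 2) * Real.exp (-s)) (Ici t) := by
    refine monotoneOn_of_hasDerivWithinAt_nonneg (convex_Ici t)
      (fun s hs => (hF s (ht.trans_le hs)).continuousAt.continuousWithinAt)
      (fun s hs => (hF s ?_).hasDerivWithinAt) (fun s hs => ?_)
    · rw [interior_Ici] at hs; exact ht.trans hs
    · rw [interior_Ici] at hs
      have hs' : t < s := hs
      have hgs : |g s| ≤ c := (hg s (ht.trans hs')).trans (by rw [hc]; gcongr)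
      have hg2 : g s ^ 2 ≤ c ^ 2 := by rw [← sq_abs (g s)]; gcongr
      have has := ha s (ht.trans hs')
      refine mul_nonneg ?_ (Real.exp_pos _).le
      nlinarith [sq_nonneg (R s + g s), mul_nonneg (sub_nonneg.2 has) (sq_nonneg (R s))]
  have hx : 0 ≤ M ^ 2 / d := by positivity
  have h1 := hmono (self_mem_Ici : t ∈ Ici t) (show t + M ^ 2 / d ∈ Ici t by simpa using hx)
    (by simpa using hx)
  simp only [← hd_def] at h1
  have h2 : d * Real.exp (M ^ 2 / d) ≤ R (t + M ^ 2 / d) ^ 2 - c ^ 2 := by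
    have := mul_le_mul_of_nonneg_right h1 (Real.exp_pos (t + M ^ 2 / d)).le
    rw [mul_assoc, mul_assoc, ← Real.exp_add, ← Real.exp_add] at this
    simpa using this
  have h3 : R (t + M ^ 2 / d) ^ 2 ≤ M ^ 2 := by
    rw [← sq_abs (R _)]
    have := hM (t + M ^ 2 / d) (by linarith)
    gcongr
  have h4 := mul_le_mul_of_nonneg_left (Real.add_one_le_exp (M ^ 2 / d)) hd.le
  have h5 : d * (M ^ 2 / d + 1) = M ^ 2 + d := by field_simp
  nlinarith [sq_nonneg c]

/-- Global solvability of a scalar autonomous equation with velocity between `1/4` and `1`. -/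
theorem exists_global_solution {ρ : ℝ → ℝ} (hρ : Continuous ρ) (h1 : ∀ s, 1 / 4 ≤ ρ s)
    (h2 : ∀ s, ρ s ≤ 1) (s₀ : ℝ) :
    ∃ S : ℝ → ℝ, S 0 = s₀ ∧ (∀ x, HasDerivAt S (ρ (S x)) x) ∧
      ∀ x, 0 ≤ x → s₀ + x / 4 ≤ S x ∧ S x ≤ s₀ + x := by
  have hpos : ∀ s, 0 < ρ s := fun s => by linarith [h1 s]
  have hinv : Continuous fun s => (ρ s)⁻¹ := hρ.inv₀ fun s => (hpos s).ne'
  let H : ℝ → ℝ := fun s => ∫ t in s₀..s, (ρ t)⁻¹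
  have hH : ∀ s, HasDerivAt H (ρ s)⁻¹ s := fun s =>
    intervalIntegral.integral_hasDerivAt_right (hinv.intervalIntegrable _ _)
      (hinv.stronglyMeasurableAtFilter _ _) hinv.continuousAt
  have hHc : Continuous H := continuous_iff_continuousAt.2 fun s => (hH s).continuousAt
  have hmono : StrictMono H := strictMono_of_hasDerivAt_pos hH fun s => inv_pos.2 (hpos s)
  have hid : Monotone fun s => H s - s :=
    monotone_of_hasDerivAt_nonneg (fun s => (hH s).sub (hasDerivAt_id s)) fun s =>
      sub_nonneg.2 ((one_le_inv₀ (hpos s)).2 (h2 s))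
  have htop : Tendsto H atTop atTop := by
    refine tendsto_atTop_mono' _ ?_ (tendsto_atTop_add_const_right _ (H 0) tendsto_id)
    filter_upwards [eventually_ge_atTop 0] with s hs
    have := hid hs
    simp only [id] at *
    linarith
  have hbot : Tendsto H atBot atBot := by
    refine tendsto_atBot_mono' _ ?_ (tendsto_atBot_add_const_right _ (H 0) tendsto_id)
    filter_upwards [eventually_le_atBot 0] with s hs
    have := hid hs
    simp only [id] at *
    linarith
  have hsurj : Function.Surjective H := hHc.surjective htop hbot
  let e := hmono.orderIsoOfSurjective H hsurj
  have he : ∀ x, H (e.symm x) = x := fun x => e.apply_symm_apply x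
  have hS : ∀ x, HasDerivAt e.symm (ρ (e.symm x)) x := fun x => by
    have := HasDerivAt.of_local_left_inverse (f := H) (g := e.symm) (a := x)
      e.symm.continuous.continuousAt (hH _) (inv_ne_zero (hpos _).ne')
      (Eventually.of_forall he)
    simpa using this
  have h0 : e.symm 0 = s₀ := hmono.injective (by rw [he]; simp [H])
  refine ⟨e.symm, h0, hS, fun x hx => ⟨?_, ?_⟩⟩
  · have := monotone_of_hasDerivAt_nonneg
      (fun x => (hS x).sub ((hasDerivAt_id x).div_const 4))
      (fun x => by simpa using h1 (e.symm x)) hx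
    simp only [h0, id, Pi.sub_apply] at this
    linarith
  · have := monotone_of_hasDerivAt_nonneg
      (fun x => (hasDerivAt_id x).sub (hS x)) (fun x => by simpa using h2 (e.symm x)) hx
    simp only [h0, id, Pi.sub_apply] at this
    linarith

/-- The equation `r' = 1 - 1 / (2 r) + 3 r / (2 t)` has a solution close to `1 / 2` near infinity. -/
theorem exists_slope_profile :
    ∃ r : ℝ → ℝ, Continuous r ∧ (∀ t, |r t - 1 / 2| ≤ 1 / 100) ∧
      ∀ t, 100 < t → HasDerivAt r (1 - 1 / (2 * r t) + 3 * r t / (2 * t)) t := by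
  let c : ℝ → ℝ := fun y => max (min y (1 / 20)) (-1 / 20)
  have hcont : Continuous c := by fun_prop
  have hc1 : ∀ y, -1 / 20 ≤ c y := fun y => le_max_right _ _
  have hc2 : ∀ y, c y ≤ 1 / 20 := fun y => max_le (min_le_right _ _) (by norm_num)
  have hcL : ∀ y z, |c y - c z| ≤ |y - z| := fun y z =>
    (abs_max_sub_max_le_abs _ _ _).trans (abs_min_sub_min_le_max _ _ _ _ |>.trans (by simp))
  have hτ : ∀ t : ℝ, 0 ≤ (max t 100)⁻¹ ∧ (max t 100)⁻¹ ≤ 1 / 100 := fun t =>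
    ⟨by positivity, by
      rw [inv_le_comm₀ (by positivity) (by norm_num)]
      norm_num⟩
  let N : ℝ → ℝ → ℝ := fun t y =>
    -4 * (c y ^ 2 / (1 + 2 * c y)) + 3 / 2 * (1 / 2 + c y) * (max t 100)⁻¹
  have hden : ∀ y, 9 / 10 ≤ 1 + 2 * c y := fun y => by linarith [hc1 y]
  have hN : Continuous fun p : ℝ × ℝ => N p.1 p.2 := by
    have h1 : ∀ p : ℝ × ℝ, 1 + 2 * c p.2 ≠ 0 := fun p => by linarith [hden p.2]
    have h2 : ∀ p : ℝ × ℝ, max p.1 100 ≠ 0 := fun p => by positivity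
    simp only [N]
    fun_prop (disch := assumption)
  have hB : ∀ t y, |N t y| ≤ 1 / 50 := fun t y => by
    obtain ⟨h0, h1⟩ := hτ t
    have hq0 : 0 ≤ c y ^ 2 / (1 + 2 * c y) := div_nonneg (sq_nonneg _) (by linarith [hden y])
    have hq1 : c y ^ 2 / (1 + 2 * c y) ≤ 1 / 360 := by
      rw [div_le_iff₀ (by linarith [hden y])]
      nlinarith [hden y, hc1 y, hc2 y]
    change |-4 * (c y ^ 2 / (1 + 2 * c y)) + 3 / 2 * (1 / 2 + c y) * (max t 100)⁻¹| ≤ 1 / 50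
    have h2 := hc1 y
    have h3 := hc2 y
    have h4 : 0 ≤ (1 / 2 + c y) * (max t 100)⁻¹ := mul_nonneg (by linarith) h0
    have h5 : (1 / 2 + c y) * (max t 100)⁻¹ ≤ 11 / 20 * (1 / 100) :=
      mul_le_mul (by linarith) h1 h0 (by norm_num)
    rw [abs_le]
    constructor <;> linarith
  have hL : ∀ t y z, |N t y - N t z| ≤ |y - z| := fun t y z => by
    obtain ⟨h0, h1⟩ := hτ t
    refine le_trans ?_ (hcL y z)
    have hy := hden y
    have hz := hden z
    have hp : 81 / 100 ≤ (1 + 2 * c y) * (1 + 2 * c z) := by nlinarith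
    have hfac : N t y - N t z = (c y - c z) * (-4 * ((c y + c z + 2 * c y * c z) /
        ((1 + 2 * c y) * (1 + 2 * c z))) + 3 / 2 * (max t 100)⁻¹) := by
      have h2 : 1 + 2 * c y ≠ 0 := by linarith
      have h3 : 1 + 2 * c z ≠ 0 := by linarith
      have hsub : c y ^ 2 / (1 + 2 * c y) - c z ^ 2 / (1 + 2 * c z) =
          (c y - c z) * ((c y + c z + 2 * c y * c z) / ((1 + 2 * c y) * (1 + 2 * c z))) := by
        rw [div_sub_div _ _ h2 h3, ← mul_div_assoc]
        congr 1
        ring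
      simp only [N]
      linear_combination -4 * hsub
    have hq : |(c y + c z + 2 * c y * c z) / ((1 + 2 * c y) * (1 + 2 * c z))| ≤ 1 / 5 := by
      have : |c y + c z + 2 * c y * c z| ≤ 3 / 20 := by
        rw [abs_le]
        constructor <;> nlinarith [hc1 y, hc2 y, hc1 z, hc2 z]
      rw [abs_div, abs_of_pos (show 0 < (1 + 2 * c y) * (1 + 2 * c z) by linarith),
        div_le_iff₀ (by linarith)]
      linarith
    rw [hfac, abs_mul]
    refine mul_le_of_le_one_right (abs_nonneg _) ?_
    rw [abs_le] at hq ⊢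
    constructor <;> linarith
  obtain ⟨y, hy⟩ := exists_bounded_solution hN hB hL
  have hyb : ∀ t, |y t| ≤ 1 / 100 := fun t => (hy t).2.trans (by norm_num)
  refine ⟨fun t => 1 / 2 + y t, ?_, fun t => by simpa using hyb t, fun t ht => ?_⟩
  · exact continuous_const.add (continuous_iff_continuousAt.2 fun t => (hy t).1.continuousAt)
  · refine ((hy t).1.const_add _).congr_deriv ?_
    obtain ⟨h1, h2⟩ := abs_le.1 (hyb t)
    have hcy : c (y t) = y t := by
      simp only [c]
      rw [min_eq_left (by linarith), max_eq_left (by linarith)]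
    have ht0 : t ≠ 0 := by linarith
    have h3 : 1 + 2 * y t ≠ 0 := by linarith
    have h4 : 2 * (1 / 2 + y t) = 1 + 2 * y t := by ring
    simp only [N, hcy, max_eq_left ht.le]
    rw [h4]
    field_simp
    ring

theorem abs_add_le_of_le {x y X Y : ℝ} (hx : |x| ≤ X) (hy : |y| ≤ Y) : |x + y| ≤ X + Y :=
  (abs_add_le x y).trans (add_le_add hx hy)

theorem abs_sub_le_of_le {x y X Y : ℝ} (hx : |x| ≤ X) (hy : |y| ≤ Y) : |x - y| ≤ X + Y :=
  (abs_sub x y).trans (add_le_add hx hy)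

theorem abs_mul_le_of_le {x y X Y : ℝ} (hx : |x| ≤ X) (hy : |y| ≤ Y) : |x * y| ≤ X * Y := by
  rw [abs_mul]
  exact mul_le_mul hx hy (abs_nonneg y) ((abs_nonneg x).trans hx)

theorem abs_pow_le_of_le {x X : ℝ} (hx : |x| ≤ X) (n : ℕ) : |x ^ n| ≤ X ^ n := by
  rw [abs_pow]
  exact pow_le_pow_left₀ (abs_nonneg x) hx n

/-- Decay of the first three derivatives of bounded solutions of
`r' = 1 - 1 / (2 r) + 3 r / (2 t)`. -/
theorem exists_slope_profile_deriv_decay {r : ℝ → ℝ} (hr : ∀ t, |r t - 1 / 2| ≤ 1 / 100)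
    (hr' : ∀ t, 100 < t → HasDerivAt r (1 - 1 / (2 * r t) + 3 * r t / (2 * t)) t) :
    ∃ (r₁ r₂ r₃ : ℝ → ℝ) (K : ℝ), 1 ≤ K ∧ ∀ t, 100 < t →
      r₁ t = 1 - 1 / (2 * r t) + 3 * r t / (2 * t) ∧
      HasDerivAt r (r₁ t) t ∧ HasDerivAt r₁ (r₂ t) t ∧ HasDerivAt r₂ (r₃ t) t ∧
      |r₁ t| ≤ K / t ^ 1 ∧ |r₂ t| ≤ K / t ^ 2 ∧ |r₃ t| ≤ K / t ^ 3 := by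
  let w : ℝ → ℝ := fun t => (r t)⁻¹
  let i : ℝ → ℝ := fun t => t⁻¹
  let r₁ : ℝ → ℝ := fun t => 1 - 1 / 2 * w t + 3 / 2 * r t * i t
  let a : ℝ → ℝ := fun t => 1 / 2 * w t ^ 2 + 3 / 2 * i t
  let b : ℝ → ℝ := fun t => r₁ t * w t ^ 3 + 3 / 2 * i t ^ 2
  let g₁ : ℝ → ℝ := fun t => -3 / 2 * r t * i t ^ 2
  let g₂ : ℝ → ℝ := fun t =>
    3 * r t * i t ^ 3 - r₁ t ^ 2 * w t ^ 3 - 3 * r₁ t * i t ^ 2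
  let r₂ : ℝ → ℝ := fun t => a t * r₁ t + g₁ t
  let r₃ : ℝ → ℝ := fun t => a t * r₂ t + g₂ t
  let g₃ : ℝ → ℝ := fun t => 3 * r₁ t ^ 3 * w t ^ 4 - b t * r₂ t
    - 2 * r₁ t * r₂ t * w t ^ 3 - 3 * r₂ t * i t ^ 2 + 9 * r₁ t * i t ^ 3 - 9 * r t * i t ^ 4
  have hlo : ∀ t, 49 / 100 ≤ r t := fun t => by linarith [(abs_le.1 (hr t)).1]
  have hhi : ∀ t, r t ≤ 51 / 100 := fun t => by linarith [(abs_le.1 (hr t)).2]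
  have hne : ∀ t, r t ≠ 0 := fun t => by linarith [hlo t]
  have heq : ∀ t, r₁ t = 1 - 1 / (2 * r t) + 3 * r t / (2 * t) := fun t => by
    simp only [r₁, w, i]
    rw [mul_comm 2 t, ← div_div, ← div_div]
    ring
  have hd₀ : ∀ t, 100 < t → HasDerivAt r (r₁ t) t := fun t ht => heq t ▸ hr' t ht
  have hdi : ∀ t, 100 < t → HasDerivAt i (-i t ^ 2) t := fun t ht =>
    (hasDerivAt_inv (by linarith : t ≠ 0)).congr_deriv (by simp [i])
  have hdw : ∀ t, 100 < t → HasDerivAt w (-r₁ t * w t ^ 2) t := fun t ht =>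
    ((hd₀ t ht).inv (hne t)).congr_deriv (by simp only [w]; ring)
  have hda : ∀ t, 100 < t → HasDerivAt a (-b t) t := fun t ht =>
    ((((hdw t ht).pow 2).const_mul (1 / 2)).add ((hdi t ht).const_mul (3 / 2))).congr_deriv
      (by simp only [b]; push_cast; ring)
  have hd₁ : ∀ t, 100 < t → HasDerivAt r₁ (r₂ t) t := fun t ht =>
    ((((hdw t ht).const_mul (1 / 2)).const_sub 1).add
      (((hd₀ t ht).const_mul (3 / 2)).mul (hdi t ht))).congr_deriv
      (by simp only [r₂, g₁, a]; ring)
  have hdg₁ : ∀ t, 100 < t → HasDerivAt g₁ (-3 / 2 * r₁ t * i t ^ 2 + 3 * r t * i t ^ 3) t :=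
    fun t ht => (((hd₀ t ht).const_mul (-3 / 2)).mul ((hdi t ht).pow 2)).congr_deriv
      (by push_cast; simp only [Pi.pow_apply]; ring)
  have hd₂ : ∀ t, 100 < t → HasDerivAt r₂ (r₃ t) t := fun t ht =>
    (((hda t ht).mul (hd₁ t ht)).add (hdg₁ t ht)).congr_deriv
      (by simp only [r₃, g₂, b]; ring)
  have hd₃ : ∀ t, 100 < t → HasDerivAt r₃ (a t * r₃ t + g₃ t) t := fun t ht =>
    (((hda t ht).mul (hd₂ t ht)).add
      (((((hd₀ t ht).const_mul 3).mul ((hdi t ht).pow 3)).sub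
        (((hd₁ t ht).pow 2).mul ((hdw t ht).pow 3))).sub
        (((hd₁ t ht).const_mul 3).mul ((hdi t ht).pow 2)))).congr_deriv
      (by push_cast; simp only [Pi.pow_apply, g₃]; ring)
  have hi : ∀ t, 100 < t → |i t| ≤ 1 / 100 := fun t ht => by
    have : (0 : ℝ) < t := by linarith
    rw [abs_of_pos (inv_pos.2 this)]
    change t⁻¹ ≤ 1 / 100
    rw [inv_le_comm₀ this (by norm_num)]
    norm_num
    exact ht.le
  have hr1 : ∀ t, |r t| ≤ 1 := fun t => abs_le.2 ⟨by linarith [hlo t], by linarith [hhi t]⟩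
  have hw1 : ∀ t, 19 / 10 ≤ w t := fun t => by
    change 19 / 10 ≤ (r t)⁻¹
    rw [le_inv_comm₀ (by norm_num) (by linarith [hlo t])]
    norm_num
    linarith [hhi t]
  have hw2 : ∀ t, |w t| ≤ 41 / 20 := fun t => by
    rw [abs_of_nonneg (by linarith [hw1 t])]
    change (r t)⁻¹ ≤ 41 / 20
    rw [inv_le_comm₀ (by linarith [hlo t]) (by norm_num)]
    norm_num
    linarith [hlo t]
  have ha1 : ∀ t, 100 < t → 1 ≤ a t := fun t ht => by
    have := (abs_le.1 (hi t ht)).1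
    simp only [a]
    nlinarith [hw1 t]
  have ha2 : ∀ t, 100 < t → |a t| ≤ 3 := fun t ht =>
    (abs_add_le_of_le (abs_mul_le_of_le (abs_of_pos (by norm_num)).le
      (abs_pow_le_of_le (hw2 t) 2)) (abs_mul_le_of_le (abs_of_pos (by norm_num)).le
      (hi t ht))).trans (by norm_num)
  have hnum : ∀ {x : ℝ}, 0 ≤ x → |x| ≤ x := fun hx => (abs_of_nonneg hx).le
  have hb1 : ∀ t, 100 < t → |r₁ t| ≤ 3 := fun t ht =>
    (abs_add_le_of_le (abs_sub_le_of_le abs_one.le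
      (abs_mul_le_of_le (hnum (by norm_num)) (hw2 t)))
      (abs_mul_le_of_le (abs_mul_le_of_le (hnum (by norm_num)) (hr1 t)) (hi t ht))).trans
      (by norm_num)
  have hipos : ∀ t, 100 < t → 0 < i t := fun t ht => inv_pos.2 (by linarith)
  have hi1 : ∀ t, 100 < t → i t ≤ 1 / 100 := fun t ht => (le_abs_self _).trans (hi t ht)
  have hii : ∀ t, 100 < t → |i t| ≤ i t := fun t ht => hnum (hipos t ht).le
  have hbg₁ : ∀ t, 100 < t → |g₁ t| ≤ 1 * i t := fun t ht =>
    (abs_mul_le_of_le (abs_mul_le_of_le (abs_le.2 ⟨by norm_num, by norm_num⟩ :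
      |(-3 / 2 : ℝ)| ≤ 3 / 2) (hr1 t)) (abs_pow_le_of_le (hii t ht) 2)).trans
      (by nlinarith [hipos t ht, hi1 t ht])
  have hb2 : ∀ t, 100 < t → |r₂ t| ≤ 10 := fun t ht =>
    (abs_add_le_of_le (abs_mul_le_of_le (ha2 t ht) (hb1 t ht)) (hbg₁ t ht)).trans
      (by linarith [hi1 t ht])
  have hs1 : ∀ t, 100 < t → |r₁ t| ≤ 1 * i t := fun t ht => by
    have := abs_le_of_bounded_of_hasDerivAt (n := 1) (by norm_num) zero_le_one hd₁ ha1 hb1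
      (fun t ht => by simpa [i] using hbg₁ t ht) ht
    simpa [i] using this
  have hbg₂ : ∀ t, 100 < t → |g₂ t| ≤ 20 * i t ^ 2 := fun t ht =>
    (abs_sub_le_of_le (abs_sub_le_of_le
      (abs_mul_le_of_le (abs_mul_le_of_le (hnum zero_le_three) (hr1 t))
        (abs_pow_le_of_le (hii t ht) 3))
      (abs_mul_le_of_le (abs_pow_le_of_le (hs1 t ht) 2) (abs_pow_le_of_le (hw2 t) 3)))
      (abs_mul_le_of_le (abs_mul_le_of_le (hnum zero_le_three) (hs1 t ht))
        (abs_pow_le_of_le (hii t ht) 2))).trans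
      (by nlinarith [pow_pos (hipos t ht) 2, hi1 t ht,
            mul_nonneg (pow_pos (hipos t ht) 2).le (sub_nonneg.2 (hi1 t ht))])
  have hb3 : ∀ t, 100 < t → |r₃ t| ≤ 50 := fun t ht =>
    (abs_add_le_of_le (abs_mul_le_of_le (ha2 t ht) (hb2 t ht)) (hbg₂ t ht)).trans
      (by nlinarith [hi1 t ht, hipos t ht])
  have hs2 : ∀ t, 100 < t → |r₂ t| ≤ 20 * i t ^ 2 := fun t ht => by
    have := abs_le_of_bounded_of_hasDerivAt (n := 2) (G := 20) (by norm_num) (by norm_num)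
      hd₂ ha1 hb2 (fun t ht => by simpa [i, div_eq_mul_inv] using hbg₂ t ht) ht
    simpa [i, div_eq_mul_inv] using this
  have hbb : ∀ t, 100 < t → |b t| ≤ 10 * i t := fun t ht =>
    (abs_add_le_of_le (abs_mul_le_of_le (hs1 t ht) (abs_pow_le_of_le (hw2 t) 3))
      (abs_mul_le_of_le (hnum (by norm_num)) (abs_pow_le_of_le (hii t ht) 2))).trans
      (by nlinarith [hi1 t ht, hipos t ht])
  have hbg₃ : ∀ t, 100 < t → |g₃ t| ≤ 1000 * i t ^ 3 := fun t ht =>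
    (abs_sub_le_of_le (abs_add_le_of_le (abs_sub_le_of_le (abs_sub_le_of_le (abs_sub_le_of_le
      (abs_mul_le_of_le (abs_mul_le_of_le (hnum zero_le_three) (abs_pow_le_of_le (hs1 t ht) 3))
        (abs_pow_le_of_le (hw2 t) 4))
      (abs_mul_le_of_le (hbb t ht) (hs2 t ht)))
      (abs_mul_le_of_le (abs_mul_le_of_le (abs_mul_le_of_le (hnum zero_le_two) (hs1 t ht))
        (hs2 t ht)) (abs_pow_le_of_le (hw2 t) 3)))
      (abs_mul_le_of_le (abs_mul_le_of_le (hnum zero_le_three) (hs2 t ht))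
        (abs_pow_le_of_le (hii t ht) 2)))
      (abs_mul_le_of_le (abs_mul_le_of_le (hnum (by norm_num)) (hs1 t ht))
        (abs_pow_le_of_le (hii t ht) 3)))
      (abs_mul_le_of_le (abs_mul_le_of_le (hnum (by norm_num)) (hr1 t))
        (abs_pow_le_of_le (hii t ht) 4))).trans
      (by nlinarith [pow_pos (hipos t ht) 3,
            mul_nonneg (pow_pos (hipos t ht) 3).le (sub_nonneg.2 (hi1 t ht))])
  have hs3 : ∀ t, 100 < t → |r₃ t| ≤ 1000 * i t ^ 3 := fun t ht => by
    have := abs_le_of_bounded_of_hasDerivAt (n := 3) (G := 1000) (by norm_num) (by norm_num)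
      hd₃ ha1 hb3 (fun t ht => by simpa [i, div_eq_mul_inv] using hbg₃ t ht) ht
    simpa [i, div_eq_mul_inv] using this
  refine ⟨r₁, r₂, r₃, 1000, by norm_num, fun t ht =>
    ⟨heq t, hd₀ t ht, hd₁ t ht, hd₂ t ht, ?_, ?_, ?_⟩⟩ <;>
    rw [div_eq_mul_inv, ← inv_pow]
  · exact (hs1 t ht).trans (by rw [pow_one]; linarith [hipos t ht])
  · exact (hs2 t ht).trans (by
      gcongr
      norm_num)
  · exact hs3 t ht

/-- Stationary waves `u = -V` whose derivatives are controlled by powers of `V`. -/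
theorem exists_stationary_wave :
    ∃ M : ℝ, 1 ≤ M ∧ ∀ δ ∈ Ioo (0 : ℝ) (1 / 15), ∃ V u₁ u₂ u₃ u₄ : ℝ → ℝ,
      ContinuousAt V 0 ∧ V 0 = δ ∧ ∀ x, 0 < x →
        HasDerivAt (fun x => -V x) (u₁ x) x ∧ HasDerivAt u₁ (u₂ x) x ∧
        HasDerivAt u₂ (u₃ x) x ∧ HasDerivAt u₃ (u₄ x) x ∧
        0 < V x ∧ δ / (1 + δ * x) ≤ V x ∧ V x ≤ 4 * (δ / (1 + δ * x)) ∧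
        V x ^ 2 / 4 ≤ u₁ x ∧ u₁ x ≤ V x ^ 2 ∧ |u₂ x| ≤ M * V x ^ 3 ∧ |u₃ x| ≤ M * V x ^ 4 ∧
        |u₄ x| ≤ M * V x ^ 5 ∧ u₁ x ^ 2 - V x * u₂ x - V x ^ 2 / 2 + u₁ x = 0 := by
  obtain ⟨r, hrc, hr, hr'⟩ := exists_slope_profile
  obtain ⟨r₁, r₂, r₃, K, hK, hrd⟩ := exists_slope_profile_deriv_decay hr hr'
  have hlo : ∀ t, 1 / 4 ≤ r t := fun t => by linarith [(abs_le.1 (hr t)).1]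
  have hhi : ∀ t, r t ≤ 1 := fun t => by linarith [(abs_le.1 (hr t)).2]
  obtain ⟨L, hL⟩ : ∃ L, L = 8 * K := ⟨_, rfl⟩
  have hL1 : 1 ≤ L := by linarith
  have hL2 : L ≤ L ^ 2 := by nlinarith
  have hL3 : L ^ 2 ≤ L ^ 3 := by nlinarith [sq_nonneg L]
  refine ⟨100 * L ^ 3, by linarith, fun δ hδ => ?_⟩
  obtain ⟨hδ0, hδ1⟩ := hδ
  obtain ⟨S, hS0, hS, hSb⟩ := exists_global_solution (ρ := fun s => r (s ^ 2 / 2))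
    (by fun_prop) (fun _ => hlo _) (fun _ => hhi _) δ⁻¹
  have hδinv : 15 < δ⁻¹ := by
    rw [lt_inv_comm₀ (by norm_num) hδ0]
    linarith
  have hS15 : ∀ x, 0 ≤ x → 15 < S x := fun x hx => by linarith [(hSb x hx).1]
  have hτ : ∀ x, 0 ≤ x → 100 < S x ^ 2 / 2 := fun x hx => by nlinarith [hS15 x hx]
  let V : ℝ → ℝ := fun x => (S x)⁻¹
  let A : ℝ → ℝ := fun x => r (S x ^ 2 / 2)
  let A₁ : ℝ → ℝ := fun x => r₁ (S x ^ 2 / 2)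
  let A₂ : ℝ → ℝ := fun x => r₂ (S x ^ 2 / 2)
  let A₃ : ℝ → ℝ := fun x => r₃ (S x ^ 2 / 2)
  have hSV : ∀ x, 0 ≤ x → S x * V x = 1 := fun x hx =>
    mul_inv_cancel₀ (by linarith [hS15 x hx])
  have hT : ∀ x, HasDerivAt (fun x => S x ^ 2 / 2) (S x * A x) x := fun x =>
    (((hS x).pow 2).div_const 2).congr_deriv (by push_cast; simp only [A]; ring)
  have hdA : ∀ x, 0 ≤ x → HasDerivAt A (A₁ x * (S x * A x)) x := fun x hx =>
    (hrd _ (hτ x hx)).2.1.comp x (hT x)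
  have hdA₁ : ∀ x, 0 ≤ x → HasDerivAt A₁ (A₂ x * (S x * A x)) x := fun x hx =>
    (hrd _ (hτ x hx)).2.2.1.comp x (hT x)
  have hdA₂ : ∀ x, 0 ≤ x → HasDerivAt A₂ (A₃ x * (S x * A x)) x := fun x hx =>
    (hrd _ (hτ x hx)).2.2.2.1.comp x (hT x)
  have hdV : ∀ x, 0 ≤ x → HasDerivAt V (-A x * V x ^ 2) x := fun x hx =>
    ((hS x).inv (by linarith [hS15 x hx])).congr_deriv (by simp only [V, A]; ring)
  refine ⟨V, fun x => A x * V x ^ 2, fun x => A₁ x * A x * V x - 2 * A x ^ 2 * V x ^ 3,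
    fun x => A₂ x * A x ^ 2 + A₁ x ^ 2 * A x - 5 * A₁ x * A x ^ 2 * V x ^ 2
      + 6 * A x ^ 3 * V x ^ 4,
    fun x => S x * (A₃ x * A x ^ 3 + 4 * A₂ x * A₁ x * A x ^ 2 + A₁ x ^ 3 * A x)
      - 5 * V x * (A₂ x * A x ^ 3 + 2 * A₁ x ^ 2 * A x ^ 2) + 28 * A₁ x * A x ^ 3 * V x ^ 3
      - 24 * A x ^ 4 * V x ^ 5, (hdV 0 le_rfl).continuousAt, by simp [V, hS0], fun x hx => ?_⟩
  have hx0 := hx.le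
  have hsv := hSV x hx0
  have hSpos : 0 < S x := by linarith [hS15 x hx0]
  have hV : 0 < V x := inv_pos.2 hSpos
  have hVV : |V x| ≤ V x := (abs_of_pos hV).le
  have hA0 : 1 / 4 ≤ A x := hlo _
  have hA1 : |A x| ≤ 1 := abs_le.2 ⟨by linarith, hhi _⟩
  have hnum : ∀ {x : ℝ}, 0 ≤ x → |x| ≤ x := fun hx => (abs_of_nonneg hx).le
  obtain ⟨heq, -, -, -, hb1, hb2, hb3⟩ := hrd _ (hτ x hx0)
  have hpow : ∀ k, K / (S x ^ 2 / 2) ^ k = K * 2 ^ k * V x ^ (2 * k) := fun k => by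
    simp only [V, div_pow, inv_pow, ← pow_mul]
    field_simp
  rw [hpow] at hb1 hb2 hb3
  replace hb1 : |A₁ x| ≤ L * V x ^ 2 := hb1.trans (by
    rw [mul_one]; gcongr; linarith)
  replace hb2 : |A₂ x| ≤ L * V x ^ 4 := hb2.trans (by
    norm_num1; gcongr; linarith)
  replace hb3 : |A₃ x| ≤ L * V x ^ 6 := hb3.trans (by
    norm_num1; gcongr; linarith)
  refine ⟨?_, ?_, ?_, ?_, hV, ?_, ?_, ?_, ?_, ?_, ?_, ?_, ?_⟩
  · exact (hdV x hx0).neg.congr_deriv (by ring)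
  · refine ((hdA x hx0).mul ((hdV x hx0).pow 2)).congr_deriv ?_
    push_cast
    simp only [Pi.pow_apply]
    linear_combination A₁ x * A x * V x * hsv
  · refine ((((hdA₁ x hx0).mul (hdA x hx0)).mul (hdV x hx0)).sub
      ((((hdA x hx0).pow 2).const_mul 2).mul ((hdV x hx0).pow 3))).congr_deriv ?_
    push_cast
    simp only [Pi.pow_apply, Pi.mul_apply]
    linear_combination (A₂ x * A x ^ 2 + A₁ x ^ 2 * A x - 4 * A x ^ 2 * A₁ x * V x ^ 2) * hsv
  · refine (((((hdA₂ x hx0).mul ((hdA x hx0).pow 2)).add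
      (((hdA₁ x hx0).pow 2).mul (hdA x hx0))).sub
      ((((hdA₁ x hx0).const_mul 5).mul ((hdA x hx0).pow 2)).mul ((hdV x hx0).pow 2))).add
      ((((hdA x hx0).pow 3).const_mul 6).mul ((hdV x hx0).pow 4))).congr_deriv ?_
    push_cast
    simp only [Pi.pow_apply, Pi.mul_apply]
    linear_combination (-5 * A₂ x * A x ^ 3 * V x - 10 * A₁ x ^ 2 * A x ^ 2 * V x
      + 18 * A x ^ 3 * A₁ x * V x ^ 3) * hsv
  · have h : δ / (1 + δ * x) = (δ⁻¹ + x)⁻¹ := by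
      field_simp
    rw [h]
    exact inv_anti₀ hSpos (hSb x hx0).2
  · have h : 4 * (δ / (1 + δ * x)) = (δ⁻¹ / 4 + x / 4)⁻¹ := by
      field_simp
    rw [h]
    exact inv_anti₀ (by positivity) (by linarith [(hSb x hx0).1])
  · nlinarith [sq_nonneg (V x)]
  · nlinarith [sq_nonneg (V x), (abs_le.1 hA1).2]
  · have h := abs_sub_le_of_le (abs_mul_le_of_le (abs_mul_le_of_le hb1 hA1) hVV)
      (abs_mul_le_of_le (abs_mul_le_of_le (hnum zero_le_two) (abs_pow_le_of_le hA1 2))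
        (abs_pow_le_of_le hVV 3))
    calc _ ≤ _ := h
      _ = (L + 2) * V x ^ 3 := by ring
      _ ≤ _ := by gcongr; linarith
  · have h := abs_add_le_of_le (abs_sub_le_of_le (abs_add_le_of_le
      (abs_mul_le_of_le hb2 (abs_pow_le_of_le hA1 2))
      (abs_mul_le_of_le (abs_pow_le_of_le hb1 2) hA1))
      (abs_mul_le_of_le (abs_mul_le_of_le (abs_mul_le_of_le (hnum (by norm_num : (0 : ℝ) ≤ 5)) hb1)
        (abs_pow_le_of_le hA1 2)) (abs_pow_le_of_le hVV 2)))
      (abs_mul_le_of_le (abs_mul_le_of_le (hnum (by norm_num : (0 : ℝ) ≤ 6))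
        (abs_pow_le_of_le hA1 3)) (abs_pow_le_of_le hVV 4))
    calc _ ≤ _ := h
      _ = (L ^ 2 + 6 * L + 6) * V x ^ 4 := by ring
      _ ≤ _ := by gcongr; linarith
  · have h := abs_sub_le_of_le (abs_add_le_of_le (abs_sub_le_of_le
      (abs_mul_le_of_le (hnum hSpos.le) (abs_add_le_of_le (abs_add_le_of_le
        (abs_mul_le_of_le hb3 (abs_pow_le_of_le hA1 3))
        (abs_mul_le_of_le (abs_mul_le_of_le (abs_mul_le_of_le
          (hnum (by norm_num : (0 : ℝ) ≤ 4)) hb2) hb1) (abs_pow_le_of_le hA1 2)))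
        (abs_mul_le_of_le (abs_pow_le_of_le hb1 3) hA1)))
      (abs_mul_le_of_le (abs_mul_le_of_le (hnum (by norm_num : (0 : ℝ) ≤ 5)) hVV)
        (abs_add_le_of_le (abs_mul_le_of_le hb2 (abs_pow_le_of_le hA1 3))
          (abs_mul_le_of_le (abs_mul_le_of_le (hnum zero_le_two) (abs_pow_le_of_le hb1 2))
            (abs_pow_le_of_le hA1 2)))))
      (abs_mul_le_of_le (abs_mul_le_of_le (abs_mul_le_of_le
        (hnum (by norm_num : (0 : ℝ) ≤ 28)) hb1) (abs_pow_le_of_le hA1 3))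
        (abs_pow_le_of_le hVV 3)))
      (abs_mul_le_of_le (abs_mul_le_of_le (hnum (by norm_num : (0 : ℝ) ≤ 24))
        (abs_pow_le_of_le hA1 4)) (abs_pow_le_of_le hVV 5))
    calc _ ≤ _ := h
      _ = (L ^ 3 + 14 * L ^ 2 + 34 * L + 24) * V x ^ 5 := by
        linear_combination (L ^ 3 + 4 * L ^ 2 + L) * V x ^ 5 * hsv
      _ ≤ _ := by gcongr; linarith
  · have hAA : A₁ x * A x = A x - 1 / 2 + 3 * A x ^ 2 * V x ^ 2 := by
      have hAne : A x ≠ 0 := by linarith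
      have h : A₁ x = 1 - 1 / (2 * A x) + 3 * A x / (2 * (S x ^ 2 / 2)) := heq
      rw [h]
      simp only [V]
      field_simp
    linear_combination (-V x ^ 2) * hAA

theorem hasDerivAt_deriv_of_pos {f f' : ℝ → ℝ} {f'' x : ℝ}
    (hf : ∀ x, 0 < x → HasDerivAt f (f' x) x) (hx : 0 < x) (hf' : HasDerivAt f' f'' x) :
    HasDerivAt (deriv f) f'' x :=
  hf'.congr_of_eventuallyEq (by
    filter_upwards [lt_mem_nhds hx] with y hy using (hf y hy).deriv)

/-- Existence and decay estimates of the stationary solution `ū` of the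
radiating-gas model in the degenerate case `u₊ = 0`, `u₋ = -δ`: `ū < 0`, `ū' > 0`,
`q̄ := -ū²/2` satisfies `-q̄'' + q̄ + ū' = 0`, with algebraic decay estimates for `ū` and
its derivatives up to fourth order, uniformly in small `δ`. -/
theorem stmt_10 :
    ∃ δstar C₁ C₂ : ℝ, 0 < δstar ∧ 0 < C₁ ∧ 0 < C₂ ∧
      ∀ δ ∈ Set.Ioo (0:ℝ) δstar,
        ∃ u : ℝ → ℝ,
          (∀ x ∈ Set.Ioi (0:ℝ),
            DifferentiableAt ℝ u x ∧ DifferentiableAt ℝ (deriv u) x ∧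
            DifferentiableAt ℝ (deriv (deriv u)) x ∧
            DifferentiableAt ℝ (deriv (deriv (deriv u))) x) ∧
          (∀ x ∈ Set.Ioi (0:ℝ), u x < 0 ∧ 0 < deriv u x) ∧
          Filter.Tendsto u (nhdsWithin 0 (Set.Ioi 0)) (nhds (-δ)) ∧
          Filter.Tendsto u Filter.atTop (nhds 0) ∧
          (∀ x ∈ Set.Ioi (0:ℝ),
            -(deriv (deriv (fun y => -(u y ^ 2) / 2)) x) + (-(u x ^ 2) / 2)
              + deriv u x = 0) ∧
          (∀ x ∈ Set.Ioi (0:ℝ),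
            C₁ * δ / (1 + δ * x) ≤ -(u x) ∧ -(u x) ≤ C₂ * δ / (1 + δ * x) ∧
            C₁ * δ ^ 2 / (1 + δ * x) ^ 2 ≤ deriv u x ∧
            deriv u x ≤ C₂ * δ ^ 2 / (1 + δ * x) ^ 2 ∧
            (∀ k ∈ Finset.Icc 1 4,
              |deriv^[k] u x| ≤ C₂ * δ ^ (k + 1) / (1 + δ * x) ^ (k + 1)) ∧
            |(deriv (deriv u) x) ^ 2 / deriv u x| ≤ C₂ * δ ^ 4 / (1 + δ * x) ^ 4 ∧
            |(deriv (deriv (deriv u)) x) ^ 2 / deriv u x| ≤ C₂ * δ ^ 6 / (1 + δ * x) ^ 6 ∧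
            |deriv (deriv (deriv u)) x / deriv u x| ≤ C₂ * δ ^ 2 / (1 + δ * x) ^ 2 ∧
            |deriv (deriv (deriv (deriv u))) x / deriv u x| ≤
              C₂ * δ ^ 3 / (1 + δ * x) ^ 3) := by
  obtain ⟨M, hM, hwave⟩ := exists_stationary_wave
  have hM2 : M ≤ M ^ 2 := by nlinarith
  refine ⟨1 / 15, 1 / 4, 4 ^ 7 * M ^ 2, by norm_num, by norm_num, by positivity, fun δ hδ => ?_⟩
  have hδ0 : 0 < δ := hδ.1
  obtain ⟨V, u₁, u₂, u₃, u₄, hVc, hV0, h⟩ := hwave δ hδ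
  have hd₁ : ∀ x, 0 < x → HasDerivAt (fun x => -V x) (u₁ x) x := fun x hx => (h x hx).1
  have hd₂ : ∀ x, 0 < x → HasDerivAt (deriv fun x => -V x) (u₂ x) x := fun x hx =>
    hasDerivAt_deriv_of_pos hd₁ hx (h x hx).2.1
  have hd₃ : ∀ x, 0 < x → HasDerivAt (deriv (deriv fun x => -V x)) (u₃ x) x := fun x hx =>
    hasDerivAt_deriv_of_pos hd₂ hx (h x hx).2.2.1
  have hd₄ : ∀ x, 0 < x → HasDerivAt (deriv (deriv (deriv fun x => -V x))) (u₄ x) x :=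
    fun x hx => hasDerivAt_deriv_of_pos hd₃ hx (h x hx).2.2.2.1
  refine ⟨fun x => -V x, fun x hx => ⟨(hd₁ x hx).differentiableAt, (hd₂ x hx).differentiableAt,
    (hd₃ x hx).differentiableAt, (hd₄ x hx).differentiableAt⟩, fun x hx => ?_, ?_, ?_,
    fun x hx => ?_, fun x hx => ?_⟩
  · obtain ⟨-, -, -, -, hpos, -, -, hlow, -⟩ := h x hx
    rw [(hd₁ x hx).deriv]
    exact ⟨neg_neg_of_pos hpos, lt_of_lt_of_le (by positivity) hlow⟩
  · have := hVc.neg.tendsto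
    rw [Pi.neg_apply, hV0] at this
    exact this.mono_left nhdsWithin_le_nhds
  · have hlim : Tendsto (fun x => 4 * (δ / (1 + δ * x))) atTop (𝓝 0) := by
      have h1 : Tendsto (fun x => 1 + δ * x) atTop atTop :=
        tendsto_atTop_add_const_left _ 1 (tendsto_id.const_mul_atTop hδ0)
      simpa using (h1.const_div_atTop δ).const_mul 4
    have hVlim : Tendsto V atTop (𝓝 0) := by
      refine tendsto_of_tendsto_of_tendsto_of_le_of_le' tendsto_const_nhds hlim ?_ ?_
      · filter_upwards [eventually_gt_atTop 0] with x hx using (h x hx).2.2.2.2.1.le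
      · filter_upwards [eventually_gt_atTop 0] with x hx using (h x hx).2.2.2.2.2.2.1
    simpa using hVlim.neg
  · have hq : ∀ y, 0 < y → HasDerivAt (fun y => -((-V y) ^ 2) / 2) (V y * u₁ y) y := fun y hy =>
      (((hd₁ y hy).fun_pow 2).fun_neg.div_const 2).congr_deriv (by push_cast; ring)
    have hq' : HasDerivAt (fun y => V y * u₁ y) (-u₁ x * u₁ x + V x * u₂ x) x :=
      ((hd₁ x hx).fun_neg.mul (h x hx).2.1).congr_deriv (by ring) |>.congr_of_eventuallyEq
        (Eventually.of_forall fun y => by simp)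
    rw [(hasDerivAt_deriv_of_pos hq hx hq').deriv, (hd₁ x hx).deriv]
    linear_combination (h x hx).2.2.2.2.2.2.2.2.2.2.2.2
  · obtain ⟨-, -, -, -, hpos, hVlo, hVhi, hlow, hup, hb₂, hb₃, hb₄, -⟩ := h x hx
    have hx0 : (0 : ℝ) < x := hx
    have hden : 0 < 1 + δ * x := by positivity
    obtain ⟨P, hP⟩ : ∃ P, P = δ / (1 + δ * x) := ⟨_, rfl⟩
    have hP0 : 0 < P := by rw [hP]; positivity
    rw [← hP] at hVlo hVhi
    have hform : ∀ (C : ℝ) n, C * δ ^ n / (1 + δ * x) ^ n = C * P ^ n := fun C n => by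
      rw [hP, div_pow, mul_div_assoc]
    have hform1 : ∀ C : ℝ, C * δ / (1 + δ * x) = C * P := fun C => by rw [hP, mul_div_assoc]
    have hVP : ∀ n, V x ^ n ≤ 4 ^ n * P ^ n := fun n => by
      rw [← mul_pow]
      exact pow_le_pow_left₀ hpos.le hVhi n
    have hfin : ∀ (c : ℝ) n, 0 ≤ c → c * 4 ^ n ≤ 4 ^ 7 * M ^ 2 →
        c * V x ^ n ≤ 4 ^ 7 * M ^ 2 * P ^ n := fun c n hc hcn =>
      calc c * V x ^ n ≤ c * (4 ^ n * P ^ n) := mul_le_mul_of_nonneg_left (hVP n) hc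
        _ = c * 4 ^ n * P ^ n := by ring
        _ ≤ _ := by gcongr
    have hu₁ : 0 < u₁ x := lt_of_lt_of_le (by positivity) hlow
    have hquot : ∀ {a c : ℝ} {n : ℕ}, 0 ≤ c → |a| ≤ c * V x ^ (n + 2) →
        |a / u₁ x| ≤ 4 * c * V x ^ n := fun {a c n} hc ha => by
      rw [abs_div, abs_of_pos hu₁, div_le_iff₀ hu₁]
      calc |a| ≤ c * V x ^ (n + 2) := ha
        _ = 4 * c * V x ^ n * (V x ^ 2 / 4) := by ring
        _ ≤ _ := by gcongr
    have e₂ : deriv (deriv fun x => -V x) x = u₂ x := (hd₂ x hx).deriv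
    have e₃ : deriv (deriv (deriv fun x => -V x)) x = u₃ x := (hd₃ x hx).deriv
    have e₄ : deriv (deriv (deriv (deriv fun x => -V x))) x = u₄ x := (hd₄ x hx).deriv
    simp only [hform, hform1]
    rw [e₂, e₃, e₄, (hd₁ x hx).deriv, neg_neg]
    have hM0 : 0 ≤ M := by linarith
    refine ⟨by linarith, ?_, ?_, ?_, ?_, ?_, ?_, ?_, ?_⟩
    · simpa using hfin 1 1 zero_le_one (by linarith)
    · have : P ^ 2 ≤ V x ^ 2 := by gcongr
      linarith
    · exact hup.trans (by simpa using hfin 1 2 zero_le_one (by linarith))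
    · intro k hk
      obtain ⟨hk1, hk4⟩ := Finset.mem_Icc.1 hk
      interval_cases k
      · change |deriv (fun x => -V x) x| ≤ _
        rw [(hd₁ x hx).deriv, abs_of_pos hu₁]
        exact hup.trans (by simpa using hfin 1 2 zero_le_one (by linarith))
      · change |deriv (deriv fun x => -V x) x| ≤ _
        rw [e₂]
        exact hb₂.trans (hfin M 3 hM0 (by linarith))
      · change |deriv (deriv (deriv fun x => -V x)) x| ≤ _
        rw [e₃]
        exact hb₃.trans (hfin M 4 hM0 (by linarith))
      · change |deriv (deriv (deriv (deriv fun x => -V x))) x| ≤ _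
        rw [e₄]
        exact hb₄.trans (hfin M 5 hM0 (by linarith))
    · refine (hquot (c := M ^ 2) (n := 4) (by positivity)
        ((abs_pow_le_of_le hb₂ 2).trans_eq (by ring))).trans
        (hfin _ 4 (by positivity) (by linarith))
    · refine (hquot (c := M ^ 2) (n := 6) (by positivity)
        ((abs_pow_le_of_le hb₃ 2).trans_eq (by ring))).trans
        (hfin _ 6 (by positivity) (by linarith))
    · exact (hquot (n := 2) hM0 hb₃).trans (hfin _ 2 (by positivity) (by linarith))
    · exact (hquot (n := 3) hM0 hb₄).trans (hfin _ 3 (by positivity) (by linarith))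
end

section
/- Let u₊ < 0 and s₀ > 0, and set λ₀ := (√(1 + 4u₊²) − 1)/(2|u₊|) and b := 1/(2|u₊|³). Then there exists a differentiable function ṽ : (0, s₀) → ℝ with ṽ(s) > 0 and ṽ'(s) = s/ṽ(s) − 1/√(u₊² + 2s) for all s ∈ (0, s₀), satisfying λ₀ s ≤ ṽ(s) ≤ λ₀ s + b s² for all s ∈ (0, s₀). -/
open scoped BoundedContinuousFunction NNReal in
/-- The averaging operator `p ↦ ∫₀¹ θⁿ (H (p (θ s)) - G (θ s)) dθ` is a contraction on bounded
continuous functions when `H` is `n`-Lipschitz, hence has a fixed point. -/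
lemma exists_eq_integral_pow_mul_comp (n : ℕ) (H G : ℝ → ℝ) (hH : LipschitzWith (n : ℝ≥0) H)
    (hG : Continuous G) (C : ℝ) (hC : ∀ s, |G s| ≤ C) :
    ∃ p : ℝ →ᵇ ℝ, ∀ s,
      p s = ∫ θ in (0 : ℝ)..1, θ ^ n * (H (p (s * θ)) - G (s * θ)) := by
  have hint : ∀ (p : ℝ →ᵇ ℝ) (s : ℝ), Continuous fun θ : ℝ ↦
      θ ^ n * (H (p (s * θ)) - G (s * θ)) := fun p s ↦ by
    have := hH.continuous
    fun_prop
  have hcont : ∀ p : ℝ →ᵇ ℝ, Continuous fun s : ℝ ↦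
      ∫ θ in (0 : ℝ)..1, θ ^ n * (H (p (s * θ)) - G (s * θ)) := fun p ↦ by
    have := hH.continuous
    apply intervalIntegral.continuous_parametric_intervalIntegral_of_continuous'
    fun_prop
  have hHb : ∀ (p : ℝ →ᵇ ℝ) (t : ℝ), |H (p t)| ≤ |H 0| + n * ‖p‖ := fun p t ↦ by
    have h1 := hH.dist_le_mul (p t) 0
    have h2 := p.norm_coe_le_norm t
    rw [Real.dist_eq, Real.dist_eq, sub_zero] at h1
    rw [Real.norm_eq_abs] at h2
    have h3 : (n : ℝ) * |p t| ≤ n * ‖p‖ := by gcongr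
    have h4 := abs_sub_abs_le_abs_sub (H (p t)) (H 0)
    simp only [NNReal.coe_natCast] at h1
    linarith
  have hbd : ∀ (p : ℝ →ᵇ ℝ) (s : ℝ),
      ‖∫ θ in (0 : ℝ)..1, θ ^ n * (H (p (s * θ)) - G (s * θ))‖ ≤ |H 0| + n * ‖p‖ + C :=
    fun p s ↦ by
    have h := intervalIntegral.norm_integral_le_of_norm_le_const (a := 0) (b := 1)
      (f := fun θ : ℝ ↦ θ ^ n * (H (p (s * θ)) - G (s * θ))) (C := |H 0| + n * ‖p‖ + C)
      (fun θ hθ ↦ ?_)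
    · simpa using h
    · rw [Set.uIoc_of_le zero_le_one] at hθ
      rw [norm_mul, Real.norm_eq_abs, Real.norm_eq_abs, abs_of_nonneg (pow_nonneg hθ.1.le n)]
      have h1 : θ ^ n ≤ 1 := pow_le_one₀ hθ.1.le hθ.2
      have h2 := abs_sub (H (p (s * θ))) (G (s * θ))
      have h3 := hHb p (s * θ)
      have h4 := hC (s * θ)
      exact (mul_le_of_le_one_left (abs_nonneg _) h1).trans (by linarith)
  let T : (ℝ →ᵇ ℝ) → (ℝ →ᵇ ℝ) := fun p ↦
    BoundedContinuousFunction.ofNormedAddCommGroup _ (hcont p) _ (hbd p)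
  have hT : ∀ p s, T p s = ∫ θ in (0 : ℝ)..1, θ ^ n * (H (p (s * θ)) - G (s * θ)) :=
    fun _ _ ↦ rfl
  have hcontr : ContractingWith ((n : ℝ≥0) / (n + 1)) T := by
    refine ⟨?_, LipschitzWith.of_dist_le_mul fun p q ↦ ?_⟩
    · rw [div_lt_one (by positivity)]
      exact lt_add_one _
    · rw [BoundedContinuousFunction.dist_le (by positivity)]
      intro s
      rw [hT, hT, dist_eq_norm, ← intervalIntegral.integral_sub
        ((hint p s).intervalIntegrable _ _) ((hint q s).intervalIntegrable _ _)]
      have h := intervalIntegral.norm_integral_le_of_norm_le (μ := MeasureTheory.volume)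
        (zero_le_one' ℝ) (f := fun θ : ℝ ↦ θ ^ n * (H (p (s * θ)) - G (s * θ)) -
          θ ^ n * (H (q (s * θ)) - G (s * θ))) (g := fun θ ↦ θ ^ n * (n * dist p q))
        (Filter.Eventually.of_forall fun θ hθ ↦ ?_)
        (Continuous.intervalIntegrable (by fun_prop) _ _)
      · refine h.trans_eq ?_
        rw [intervalIntegral.integral_mul_const, integral_pow]
        push_cast
        simp
        ring
      · have h1 := hH.dist_le_mul (p (s * θ)) (q (s * θ))
        have h2 : dist (p (s * θ)) (q (s * θ)) ≤ dist p q :=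
          BoundedContinuousFunction.dist_coe_le_dist _
        rw [show θ ^ n * (H (p (s * θ)) - G (s * θ)) - θ ^ n * (H (q (s * θ)) - G (s * θ))
          = θ ^ n * (H (p (s * θ)) - H (q (s * θ))) by ring, norm_mul, Real.norm_eq_abs,
          abs_of_nonneg (pow_nonneg hθ.1.le n), ← dist_eq_norm]
        refine mul_le_mul_of_nonneg_left (h1.trans ?_) (pow_nonneg hθ.1.le n)
        simp only [NNReal.coe_natCast]
        gcongr
  refine ⟨ContractingWith.fixedPoint T hcontr, fun s ↦ ?_⟩
  rw [← hT, hcontr.fixedPoint_isFixedPt.eq]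

/-- The map `x ↦ n x + 1 / max x l` is monotone and `n`-Lipschitz once `n ≥ l⁻²`. -/
lemma nat_mul_add_one_div_max_sub_mem_Icc {l : ℝ} (hl : 0 < l) {n : ℕ} (hn : 1 / l ^ 2 ≤ n)
    {x y : ℝ} (hxy : x ≤ y) :
    (n * y + 1 / max y l) - (n * x + 1 / max x l) ∈ Set.Icc 0 (n * (y - x)) := by
  have hX : l ≤ max x l := le_max_right _ _
  have hXY : max x l ≤ max y l := max_le_max_right _ hxy
  have hd : max y l - max x l ≤ y - x := by
    rcases le_total x l with h | h <;> rcases le_total y l with h' | h' <;>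
      simp only [max_eq_left, max_eq_right, h, h'] <;> linarith
  generalize max x l = X at *
  generalize max y l = Y at *
  have hX0 : 0 < X := hl.trans_le hX
  have hY0 : 0 < Y := hX0.trans_le hXY
  have heq : 1 / X - 1 / Y = (Y - X) * (1 / (X * Y)) := by field_simp
  have h1 : 1 / (X * Y) ≤ n := by
    refine le_trans ?_ hn
    gcongr
    nlinarith
  have h2 : 0 ≤ 1 / (X * Y) := by positivity
  have h3 : (Y - X) * (1 / (X * Y)) ≤ (y - x) * n := by gcongr
  have h4 : 0 ≤ (Y - X) * (1 / (X * Y)) := mul_nonneg (by linarith) h2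
  constructor <;> nlinarith

/-- Tangent line bound for the convex function `s ↦ (a² + 2s)^(-1/2)` at `0`. -/
lemma one_div_sub_le_one_div_sqrt {a s : ℝ} (ha : 0 < a) (hs : 0 ≤ s) :
    1 / a - s / a ^ 3 ≤ 1 / Real.sqrt (a ^ 2 + 2 * s) := by
  have hr : 0 < Real.sqrt (a ^ 2 + 2 * s) := Real.sqrt_pos.2 (by positivity)
  have hle : Real.sqrt (a ^ 2 + 2 * s) ≤ a + s / a := by
    rw [Real.sqrt_le_left (by positivity)]
    have : (a + s / a) ^ 2 = a ^ 2 + 2 * s + (s / a) ^ 2 := by field_simp; ring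
    rw [this]
    linarith [sq_nonneg (s / a)]
  have h1 : 1 / (a + s / a) ≤ 1 / Real.sqrt (a ^ 2 + 2 * s) := by gcongr
  refine le_trans ?_ h1
  rw [le_div_iff₀ (by positivity)]
  have : (1 / a - s / a ^ 3) * (a + s / a) = 1 - (s / a ^ 2) ^ 2 := by field_simp; ring
  rw [this]
  linarith [sq_nonneg (s / a ^ 2)]

/-- The positive root of `l = 1 / l - 1 / a`. -/
lemma sqrt_one_add_sub_one_div_spec {a l : ℝ} (ha : 0 < a)
    (hl : l = (Real.sqrt (1 + 4 * a ^ 2) - 1) / (2 * a)) : 0 < l ∧ l = 1 / l - 1 / a := by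
  have hr : 1 < Real.sqrt (1 + 4 * a ^ 2) := by
    rw [Real.lt_sqrt zero_le_one]
    nlinarith [sq_pos_of_pos ha]
  have hsq := Real.sq_sqrt (show 0 ≤ 1 + 4 * a ^ 2 by positivity)
  have hl0 : 0 < l := by
    rw [hl]
    exact div_pos (by linarith) (by positivity)
  refine ⟨hl0, ?_⟩
  have h1 : Real.sqrt (1 + 4 * a ^ 2) = 2 * a * l + 1 := by
    rw [hl]
    field_simp
    ring
  rw [h1] at hsq
  field_simp
  nlinarith

/-- If `p s = ∫₀¹ θⁿ F (s θ) dθ`, then `v s = s p s` satisfies `v' = F - n p`. -/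
lemma hasDerivAt_mul_of_eq_integral_pow {n : ℕ} {p F : ℝ → ℝ} (hF : Continuous F)
    (hp : ∀ s, p s = ∫ θ in (0 : ℝ)..1, θ ^ n * F (s * θ)) {s : ℝ} (hs : 0 < s) :
    HasDerivAt (fun s ↦ s * p s) (F s - n * p s) s := by
  set I : ℝ → ℝ := fun s ↦ ∫ σ in (0 : ℝ)..s, σ ^ n * F σ with hI
  have hIp : ∀ s, I s = s ^ (n + 1) * p s := fun s ↦ by
    have h := intervalIntegral.mul_integral_comp_mul_left (a := 0) (b := 1)
      (f := fun σ ↦ σ ^ n * F σ) s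
    simp only [mul_zero, mul_one] at h
    simp only [hI]
    rw [hp, ← h]
    simp only [mul_pow, mul_assoc, intervalIntegral.integral_const_mul, pow_succ']
  have hId : HasDerivAt I (s ^ n * F s) s := by
    have hc : Continuous fun σ : ℝ ↦ σ ^ n * F σ := by fun_prop
    exact intervalIntegral.integral_hasDerivAt_right (hc.intervalIntegrable _ _)
      (hc.stronglyMeasurableAtFilter _ _) hc.continuousAt
  have hquot := hId.div (hasDerivAt_pow n s) (pow_ne_zero n hs.ne')
  have heq : (fun s ↦ s * p s) =ᶠ[nhds s] fun s ↦ I s / s ^ n := by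
    filter_upwards [lt_mem_nhds hs] with t ht
    rw [hIp]
    field_simp
    ring
  refine (hquot.congr_of_eventuallyEq heq).congr_deriv ?_
  rw [hIp]
  rcases n with _ | n
  · simp
  · simp only [Nat.add_sub_cancel]
    field_simp
    ring

/-- Non-degenerate case `uplus < 0`: existence of a solution of the
singular ODE `ṽ'(s) = s/ṽ(s) - 1/√(uplus² + 2s)` on `(0, s₀)` satisfying
`λ₀ s ≤ ṽ(s) ≤ λ₀ s + b s²`, where `λ₀ = (√(1+4 uplus²) - 1)/(2|uplus|)` and
`b = 1/(2|uplus|³)`. -/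
theorem stmt_12 (uplus : ℝ) (hu : uplus < 0) (s₀ : ℝ) (hs₀ : 0 < s₀)
    (lam b : ℝ)
    (hlam : lam = (Real.sqrt (1 + 4 * uplus ^ 2) - 1) / (2 * |uplus|))
    (hb : b = 1 / (2 * |uplus| ^ 3)) :
    ∃ v : ℝ → ℝ,
      (∀ s ∈ Set.Ioo 0 s₀, 0 < v s) ∧
      (∀ s ∈ Set.Ioo 0 s₀,
        HasDerivAt v (s / v s - 1 / Real.sqrt (uplus ^ 2 + 2 * s)) s) ∧
      (∀ s ∈ Set.Ioo 0 s₀, lam * s ≤ v s ∧ v s ≤ lam * s + b * s ^ 2) := by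
  have ha : 0 < |uplus| := abs_pos.2 hu.ne
  rw [← sq_abs uplus] at hlam ⊢
  generalize |uplus| = a at *
  obtain ⟨hl, hleq⟩ := sqrt_one_add_sub_one_div_spec ha hlam
  obtain ⟨n, hn⟩ := exists_nat_ge (1 / lam ^ 2)
  set H : ℝ → ℝ := fun x ↦ n * x + 1 / max x lam with hHdef
  set G : ℝ → ℝ := fun s ↦ 1 / Real.sqrt (a ^ 2 + 2 * max s 0) with hGdef
  have hHmono : Monotone H := fun x y hxy ↦
    sub_nonneg.1 (nat_mul_add_one_div_max_sub_mem_Icc hl hn hxy).1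
  have hHlip : LipschitzWith (n : NNReal) H := by
    refine LipschitzWith.of_dist_le_mul fun x y ↦ ?_
    wlog hxy : x ≤ y generalizing x y
    · rw [dist_comm, dist_comm x]
      exact this y x (le_of_not_ge hxy)
    rw [dist_comm, dist_comm x, Real.dist_eq, Real.dist_eq,
      abs_of_nonneg (sub_nonneg.2 (hHmono hxy)), abs_of_nonneg (sub_nonneg.2 hxy)]
    exact (nat_mul_add_one_div_max_sub_mem_Icc hl hn hxy).2
  have hGpos : ∀ s, 0 < Real.sqrt (a ^ 2 + 2 * max s 0) := fun s ↦
    Real.sqrt_pos.2 (by positivity)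
  have hGcont : Continuous G :=
    continuous_const.div (by fun_prop) fun s ↦ (hGpos s).ne'
  have hGle : ∀ s, G s ≤ 1 / a := fun s ↦ by
    refine one_div_le_one_div_of_le ha (Real.le_sqrt_of_sq_le ?_)
    linarith [le_max_right s 0]
  obtain ⟨p, hp⟩ := exists_eq_integral_pow_mul_comp n H G hHlip hGcont (1 / a) fun s ↦ by
    rw [abs_of_nonneg (one_div_pos.2 (hGpos s)).le]
    exact hGle s
  have hFcont : Continuous fun s ↦ H (p s) - G s :=
    (hHlip.continuous.comp p.continuous).sub hGcont
  have hpl : ∀ s, lam ≤ p s := by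
    have hbdd : BddBelow (Set.range p) := p.isBounded_range.bddBelow
    have hm : ∀ s, (⨅ t, p t) ≤ p s := fun s ↦ ciInf_le hbdd s
    suffices h : lam ≤ ⨅ t, p t from fun s ↦ h.trans (hm s)
    set m := ⨅ t, p t with hmdef
    have hkey : (H m - 1 / a) / (n + 1) ≤ m := by
      refine le_ciInf fun s ↦ ?_
      have hle : ∫ θ in (0 : ℝ)..1, θ ^ n * (H m - 1 / a) ≤
          ∫ θ in (0 : ℝ)..1, θ ^ n * (H (p (s * θ)) - G (s * θ)) := by
        refine intervalIntegral.integral_mono_on zero_le_one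
          (Continuous.intervalIntegrable (by fun_prop) _ _)
          (Continuous.intervalIntegrable ?_ _ _) fun θ hθ ↦ ?_
        · exact (continuous_pow n).mul (hFcont.comp (continuous_const_mul s))
        · exact mul_le_mul_of_nonneg_left
            (sub_le_sub (hHmono (hm _)) (hGle _)) (pow_nonneg hθ.1 n)
      rw [← hp, intervalIntegral.integral_mul_const, integral_pow] at hle
      refine le_trans (le_of_eq ?_) hle
      simp
      ring
    by_contra! hlt
    rw [div_le_iff₀ (by positivity)] at hkey
    simp only [hHdef, max_eq_right hlt.le] at hkey
    linarith
  have hv : ∀ s, 0 < s → HasDerivAt (fun s ↦ s * p s)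
      (s / (s * p s) - 1 / Real.sqrt (a ^ 2 + 2 * s)) s := fun s hs ↦ by
    refine (hasDerivAt_mul_of_eq_integral_pow hFcont hp hs).congr_deriv ?_
    have hps : 0 < p s := hl.trans_le (hpl s)
    simp only [hHdef, hGdef, max_eq_left (hpl s), max_eq_left hs.le]
    field_simp
    ring
  refine ⟨fun s ↦ s * p s, fun s hs ↦ mul_pos hs.1 (hl.trans_le (hpl s)),
    fun s hs ↦ hv s hs.1, fun s hs ↦ ⟨?_, ?_⟩⟩
  · rw [mul_comm]
    exact mul_le_mul_of_nonneg_left (hpl s) hs.1.le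
  have hmono : MonotoneOn (fun s ↦ lam * s + b * s ^ 2 - s * p s) (Set.Ici 0) := by
    refine monotoneOn_of_hasDerivWithinAt_nonneg (convex_Ici 0) ?_ (f' := fun s ↦
      lam * 1 + b * (2 * s) - (s / (s * p s) - 1 / Real.sqrt (a ^ 2 + 2 * s))) ?_ ?_
    · have := p.continuous
      exact Continuous.continuousOn (by fun_prop)
    · intro t ht
      rw [interior_Ici] at ht
      have h2 : HasDerivAt (fun s : ℝ ↦ s ^ 2) (2 * t) t := by simpa using hasDerivAt_pow 2 t
      exact ((((hasDerivAt_id t).const_mul lam).add (h2.const_mul b)).sub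
        (hv t ht)).hasDerivWithinAt
    · intro t ht
      rw [interior_Ici] at ht
      have ht : 0 < t := ht
      have hpt : 0 < p t := hl.trans_le (hpl t)
      have h1 : t / (t * p t) ≤ 1 / lam := by
        rw [show t / (t * p t) = 1 / p t by field_simp]
        exact one_div_le_one_div_of_le hl (hpl t)
      have h2 := one_div_sub_le_one_div_sqrt ha ht.le
      have h3 : b * (2 * t) = t / a ^ 3 := by
        rw [hb]
        field_simp
      linarith
  have h := hmono Set.self_mem_Ici hs.1.le hs.1.le
  simp only at h
  linarith
end

section
/- Let u₊ < 0 and s₀ > 0, and set λ₀ := (√(1 + 4u₊²) − 1)/(2|u₊|) and b := 1/(2|u₊|³). Suppose ṽ : (0, s₀) → ℝ is continuous, positive, and satisfies λ₀ s ≤ ṽ(s) ≤ λ₀ s + b s² for all s ∈ (0, s₀), and define s : (0, ∞) → (0, s₀) implicitly by x = ∫_{s(x)}^{s₀} dτ/ṽ(τ) for all x > 0. Then (s₀/(1 + (b/λ₀) s₀)) · e^{−λ₀ x} ≤ s(x) ≤ s₀ · e^{−λ₀ x} for all x > 0. -/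
/-- Integrating `f ≤ 1 / (c τ)` from `a` to `t` bounds `a` by an exponential of the integral. -/
theorem le_mul_exp_of_integral_le {a t c : ℝ} (ha : 0 < a) (hat : a ≤ t) (hc : 0 < c)
    {f : ℝ → ℝ} (hf : IntervalIntegrable f MeasureTheory.volume a t)
    (hle : ∀ τ ∈ Set.Ioo a t, f τ ≤ 1 / (c * τ)) :
    a ≤ t * Real.exp (-c * ∫ τ in a..t, f τ) := by
  have ht : 0 < t := ha.trans_le hat
  have hI : ∀ τ ∈ Set.uIcc a t, 0 < τ := fun τ hτ => by
    rw [Set.uIcc_of_le hat] at hτ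
    exact ha.trans_le hτ.1
  have hint : IntervalIntegrable (fun τ => 1 / (c * τ)) MeasureTheory.volume a t := by
    refine ContinuousOn.intervalIntegrable (ContinuousOn.div (by fun_prop) (by fun_prop) ?_)
    intro τ hτ
    exact (mul_pos hc (hI τ hτ)).ne'
  have hval : ∫ τ in a..t, 1 / (c * τ) = Real.log t / c - Real.log a / c := by
    refine intervalIntegral.integral_eq_sub_of_hasDerivAt (f := fun τ => Real.log τ / c) ?_ hint
    intro τ hτ
    have hτ0 := hI τ hτ
    refine ((Real.hasDerivAt_log hτ0.ne').div_const c).congr_deriv ?_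
    field_simp
  have hmono := intervalIntegral.integral_mono_on_of_le_Ioo hat hf hint hle
  rw [hval, ← sub_div, le_div_iff₀ hc] at hmono
  rw [← Real.log_le_log_iff ha (by positivity), Real.log_mul ht.ne' (Real.exp_pos _).ne',
    Real.log_exp]
  linarith

/-- Integrating `1 / (c τ + b τ²) ≤ f` from `a` to `t` bounds `a` from below by an exponential
of the integral. -/
theorem div_mul_exp_le_of_le_integral {a t c b : ℝ} (ha : 0 < a) (hat : a ≤ t) (hc : 0 < c)
    (hb : 0 ≤ b) {f : ℝ → ℝ} (hf : IntervalIntegrable f MeasureTheory.volume a t)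
    (hle : ∀ τ ∈ Set.Ioo a t, 1 / (c * τ + b * τ ^ 2) ≤ f τ) :
    t / (1 + b / c * t) * Real.exp (-c * ∫ τ in a..t, f τ) ≤ a := by
  have ht : 0 < t := ha.trans_le hat
  have hI : ∀ τ ∈ Set.uIcc a t, 0 < τ := fun τ hτ => by
    rw [Set.uIcc_of_le hat] at hτ
    exact ha.trans_le hτ.1
  have hint : IntervalIntegrable (fun τ => 1 / (c * τ + b * τ ^ 2))
      MeasureTheory.volume a t := by
    refine ContinuousOn.intervalIntegrable (ContinuousOn.div (by fun_prop) (by fun_prop) ?_)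
    intro τ hτ
    have := hI τ hτ
    positivity
  have hval : ∫ τ in a..t, 1 / (c * τ + b * τ ^ 2) =
      (Real.log t - Real.log (1 + b / c * t)) / c - (Real.log a - Real.log (1 + b / c * a)) / c := by
    refine intervalIntegral.integral_eq_sub_of_hasDerivAt
      (f := fun τ => (Real.log τ - Real.log (1 + b / c * τ)) / c) ?_ hint
    intro τ hτ
    have hτ0 := hI τ hτ
    have hpos : 0 < 1 + b / c * τ := by positivity
    have hlin : HasDerivAt (fun τ : ℝ => 1 + b / c * τ) (b / c) τ := by
      simpa using ((hasDerivAt_id τ).const_mul (b / c)).const_add 1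
    refine (((Real.hasDerivAt_log hτ0.ne').sub (hlin.log hpos.ne')).div_const c).congr_deriv ?_
    have h1 : 0 < c + b * τ := by positivity
    have h2 : c * τ + b * τ ^ 2 = τ * (c + b * τ) := by ring
    have h3 : 1 + b / c * τ = (c + b * τ) / c := by field_simp
    rw [h2, h3]
    field_simp
    ring
  have hmono := intervalIntegral.integral_mono_on_of_le_Ioo hat hint hf hle
  rw [hval, ← sub_div, div_le_iff₀ hc] at hmono
  have hlog : 0 ≤ Real.log (1 + b / c * a) :=
    Real.log_nonneg (le_add_of_nonneg_right (by positivity))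
  have hden : 0 < 1 + b / c * t := by positivity
  rw [← Real.log_le_log_iff (by positivity) ha,
    Real.log_mul (div_pos ht hden).ne' (Real.exp_pos _).ne', Real.log_exp,
    Real.log_div ht.ne' hden.ne']
  linarith


/-- Non-degenerate case `uplus < 0`: exponential decay of the function
`s(x)` defined implicitly by `x = ∫_{s(x)}^{s₀} dτ/ṽ(τ)`, given the two-sided bound
`λ₀ s ≤ ṽ(s) ≤ λ₀ s + b s²` with `λ₀ = (√(1+4 uplus²) - 1)/(2|uplus|)` and
`b = 1/(2|uplus|³)`:
`(s₀/(1 + (b/λ₀) s₀)) e^{-λ₀ x} ≤ s(x) ≤ s₀ e^{-λ₀ x}`. -/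
theorem stmt_13 (uplus : ℝ) (hu : uplus < 0) (s₀ : ℝ) (hs₀ : 0 < s₀)
    (lam b : ℝ)
    (hlam : lam = (Real.sqrt (1 + 4 * uplus ^ 2) - 1) / (2 * |uplus|))
    (hb : b = 1 / (2 * |uplus| ^ 3))
    (v : ℝ → ℝ)
    (hc : ContinuousOn v (Set.Ioo 0 s₀))
    (hpos : ∀ s ∈ Set.Ioo 0 s₀, 0 < v s)
    (hbd : ∀ s ∈ Set.Ioo 0 s₀, lam * s ≤ v s ∧ v s ≤ lam * s + b * s ^ 2)
    (S : ℝ → ℝ)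
    (hS : ∀ x ∈ Set.Ioi (0:ℝ), S x ∈ Set.Ioo 0 s₀ ∧ x = ∫ τ in S x..s₀, 1 / v τ) :
    ∀ x ∈ Set.Ioi (0:ℝ),
      s₀ / (1 + b / lam * s₀) * Real.exp (-lam * x) ≤ S x ∧
      S x ≤ s₀ * Real.exp (-lam * x) := by
  intro x hx
  have hx0 : 0 < x := hx
  obtain ⟨⟨hS0, hSs⟩, hxS⟩ := hS x hx
  have hu0 : 0 < |uplus| := abs_pos.mpr hu.ne
  have hlam0 : 0 < lam := by
    rw [hlam]
    have hsqrt : 1 < Real.sqrt (1 + 4 * uplus ^ 2) := by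
      rw [Real.lt_sqrt zero_le_one]
      nlinarith [mul_pos_of_neg_of_neg hu hu]
    exact div_pos (sub_pos.mpr hsqrt) (by positivity)
  have hb0 : 0 ≤ b := by
    rw [hb]
    positivity
  have hint : IntervalIntegrable (fun τ => 1 / v τ) MeasureTheory.volume (S x) s₀ := by
    by_contra h
    rw [intervalIntegral.integral_undef h] at hxS
    exact hx0.ne' hxS
  have hmem : ∀ τ ∈ Set.Ioo (S x) s₀, τ ∈ Set.Ioo 0 s₀ := fun τ hτ => ⟨hS0.trans hτ.1, hτ.2⟩
  have hlower := div_mul_exp_le_of_le_integral hS0 hSs.le hlam0 hb0 hint fun τ hτ =>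
    one_div_le_one_div_of_le (hpos τ (hmem τ hτ)) (hbd τ (hmem τ hτ)).2
  have hupper := le_mul_exp_of_integral_le hS0 hSs.le hlam0 hint fun τ hτ =>
    one_div_le_one_div_of_le (mul_pos hlam0 (hmem τ hτ).1) (hbd τ (hmem τ hτ)).1
  rw [← hxS] at hlower hupper
  exact ⟨hlower, hupper⟩
end

section
/- For every u₊ < 0 there exist positive constants δ*, C, λ such that for every u₋ ∈ (u₊ − δ*, u₊), setting δ := u₊ − u₋, there exist a three-times differentiable function ū : [0, ∞) → ℝ and a twice differentiable function q̄ : [0, ∞) → ℝ satisfying ū(x) ū'(x) + q̄'(x) = 0 and −q̄''(x) + q̄(x) + ū'(x) = 0 for all x > 0, ū(0) = u₋, lim_{x→∞} ū(x) = u₊, lim_{x→∞} q̄(x) = 0, and such that for all x ≥ 0: ū'(x) > 0, |∂ₓᵏ(ū(x) − u₊)| ≤ C δ e^{−λ x} for k = 0, 1, 2, 3, |ū''(x)²/ū'(x)| ≤ C δ, and |ū'''(x)²/ū'(x)| ≤ C δ. -/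
open Finset.HasAntidiagonal (antidiagonal mem_antidiagonal)

theorem exists_quadratic_recurrence (κ : ℕ → ℕ → ℝ) {K : ℝ} (hK : 0 ≤ K)
    (hκ : ∀ i j, |κ i j| ≤ K) :
    ∃ d : ℕ → ℝ, d 0 = 1 ∧
      (∀ n, d (n + 1) = ∑ p ∈ antidiagonal n, κ p.1 p.2 * d p.1 * d p.2) ∧
      ∀ n, |d n| ≤ (4 * K) ^ n := by
  let d : ℕ → ℝ := fun n => Nat.strongRecOn n (motive := fun _ => ℝ) fun n ih =>
    match n, ih with
    | 0, _ => 1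
    | m + 1, ih => ∑ i : Fin (m + 1),
        κ i (m - i) * ih i (by omega) * ih (m - i) (by omega)
  have h0 : d 0 = 1 := by
    simp only [d]; rw [Nat.strongRecOn_eq]
  have hs : ∀ n, d (n + 1) = ∑ p ∈ antidiagonal n, κ p.1 p.2 * d p.1 * d p.2 := by
    intro n
    rw [Finset.Nat.sum_antidiagonal_eq_sum_range_succ (fun i j => κ i j * d i * d j) n,
      Finset.sum_range]
    simp only [d]
    rw [Nat.strongRecOn_eq]
  refine ⟨d, h0, hs, ?_⟩
  have hcat : ∀ n, |d n| ≤ K ^ n * catalan n := by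
    intro n
    induction n using Nat.strong_induction_on with
    | _ n ih =>
      cases n with
      | zero => simp [h0]
      | succ m =>
        rw [hs, catalan_succ', Nat.cast_sum, Finset.mul_sum]
        refine (Finset.abs_sum_le_sum_abs _ _).trans (Finset.sum_le_sum fun p hp => ?_)
        have hp' := mem_antidiagonal.1 hp
        have h1 := ih p.1 (by omega)
        have h2 := ih p.2 (by omega)
        rw [abs_mul, abs_mul]
        calc |κ p.1 p.2| * |d p.1| * |d p.2|
            ≤ K * (K ^ p.1 * catalan p.1) * (K ^ p.2 * catalan p.2) := by
              gcongr
              exact hκ _ _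
          _ = K ^ (m + 1) * ((catalan p.1 * catalan p.2 : ℕ) : ℝ) := by
              rw [← hp']; push_cast; ring
  intro n
  refine (hcat n).trans ?_
  have h4 : catalan n ≤ 4 ^ n := by
    rw [catalan_eq_centralBinom_div]
    refine (Nat.div_le_self _ _).trans ?_
    rw [Nat.centralBinom_eq_two_mul_choose]
    exact (Nat.choose_le_two_pow _ _).trans (by rw [pow_mul]; norm_num)
  have h4' : (catalan n : ℝ) ≤ 4 ^ n := by exact_mod_cast h4
  rw [mul_pow, mul_comm]
  gcongr

/-- The series `∑ (m + 1) ^ j d_m y ^ (m + 1)`, i.e. `(y d/dy) ^ j` applied to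
`∑ d_m y ^ (m + 1)`. -/
noncomputable def eulerSeries (d : ℕ → ℝ) (j : ℕ) (y : ℝ) : ℝ :=
  ∑' m : ℕ, ((m : ℝ) + 1) ^ j * d m * y ^ (m + 1)

/-- The constant `∑ (m + 1) ^ j 2 ^ (-m)` bounding Euler series. -/
noncomputable def eulerConst (j : ℕ) : ℝ := ∑' m : ℕ, ((m : ℝ) + 1) ^ j * (1 / 2) ^ m

theorem summable_eulerConst (j : ℕ) :
    Summable fun m : ℕ => ((m : ℝ) + 1) ^ j * (1 / 2 : ℝ) ^ m := by
  have h := (summable_nat_add_iff 1).2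
    (summable_pow_mul_geometric_of_norm_lt_one j (r := (1 / 2 : ℝ)) (by norm_num))
  refine (h.mul_left 2).congr fun m => ?_
  push_cast; ring

theorem eulerConst_pos (j : ℕ) : 0 < eulerConst j :=
  (summable_eulerConst j).tsum_pos (fun m => by positivity) 0 (by norm_num)

section

variable {d : ℕ → ℝ} {L : ℝ} (hL : 0 < L) (hd : ∀ n, |d n| ≤ L ^ n)
include hL hd

theorem abs_mul_pow_le {y : ℝ} (hy : |y| * L ≤ 1 / 2) (m : ℕ) : |d m| * |y| ^ m ≤ (1 / 2) ^ m :=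
  calc |d m| * |y| ^ m ≤ L ^ m * |y| ^ m := by gcongr; exact hd m
    _ = (|y| * L) ^ m := by rw [mul_pow, mul_comm]
    _ ≤ (1 / 2) ^ m := by gcongr

theorem abs_eulerSeries_term_le (j : ℕ) {y : ℝ} (hy : |y| * L ≤ 1 / 2) (m : ℕ) :
    |((m : ℝ) + 1) ^ j * d m * y ^ (m + 1)| ≤ |y| * (((m : ℝ) + 1) ^ j * (1 / 2) ^ m) := by
  have h := abs_mul_pow_le hL hd hy m
  have hm : |(m : ℝ) + 1| = m + 1 := abs_of_pos (by positivity)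
  calc _ = |y| * (((m : ℝ) + 1) ^ j * (|d m| * |y| ^ m)) := by
        rw [abs_mul, abs_mul, abs_pow, abs_pow, hm]; ring
    _ ≤ _ := by gcongr

theorem summable_norm_eulerSeries (j : ℕ) {y : ℝ} (hy : |y| * L ≤ 1 / 2) :
    Summable fun m : ℕ => ‖((m : ℝ) + 1) ^ j * d m * y ^ (m + 1)‖ :=
  .of_nonneg_of_le (fun _ => norm_nonneg _) (abs_eulerSeries_term_le hL hd j hy)
    ((summable_eulerConst j).mul_left _)

theorem summable_eulerSeries (j : ℕ) {y : ℝ} (hy : |y| * L ≤ 1 / 2) :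
    Summable fun m : ℕ => ((m : ℝ) + 1) ^ j * d m * y ^ (m + 1) :=
  (summable_norm_eulerSeries hL hd j hy).of_norm

theorem abs_eulerSeries_le (j : ℕ) {y : ℝ} (hy : |y| * L ≤ 1 / 2) :
    |eulerSeries d j y| ≤ eulerConst j * |y| := by
  have h : ‖eulerSeries d j y‖ ≤ |y| * eulerConst j :=
    tsum_of_norm_bounded ((summable_eulerConst j).hasSum.mul_left _)
      (abs_eulerSeries_term_le hL hd j hy)
  rwa [mul_comm, ← Real.norm_eq_abs]

theorem abs_eulerSeries_sub_le (hd0 : d 0 = 1) (j : ℕ) {y : ℝ} (hy : |y| * L ≤ 1 / 2) :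
    |eulerSeries d j y - y| ≤ 2 * L * eulerConst j * y ^ 2 := by
  rw [eulerSeries, (summable_eulerSeries hL hd j hy).tsum_eq_zero_add]
  simp only [hd0, Nat.cast_zero, zero_add, one_pow, pow_one, one_mul, add_sub_cancel_left]
  have hs := (summable_nat_add_iff 1).2 (summable_eulerConst j)
  have hle : ∑' m : ℕ, (((m + 1 : ℕ) : ℝ) + 1) ^ j * (1 / 2 : ℝ) ^ (m + 1) ≤ eulerConst j := by
    rw [eulerConst, (summable_eulerConst j).tsum_eq_zero_add]
    simp
  rw [← Real.norm_eq_abs]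
  refine (tsum_of_norm_bounded (hs.mul_left (2 * L * y ^ 2)).hasSum fun m => ?_).trans ?_
  · have h : |d (m + 1)| * |y| ^ m ≤ 2 * L * (1 / 2) ^ (m + 1) :=
      calc |d (m + 1)| * |y| ^ m ≤ L ^ (m + 1) * |y| ^ m := by gcongr; exact hd _
        _ = L * (|y| * L) ^ m := by ring
        _ ≤ L * (1 / 2) ^ m := by gcongr
        _ = _ := by ring
    have hm : |((m + 1 : ℕ) : ℝ) + 1| = (m + 1 : ℕ) + 1 := abs_of_pos (by positivity)
    rw [Real.norm_eq_abs]
    calc _ = y ^ 2 * ((((m + 1 : ℕ) : ℝ) + 1) ^ j * (|d (m + 1)| * |y| ^ m)) := by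
          rw [abs_mul, abs_mul, abs_pow, abs_pow, hm, ← sq_abs y]; ring
      _ ≤ y ^ 2 * ((((m + 1 : ℕ) : ℝ) + 1) ^ j * (2 * L * (1 / 2) ^ (m + 1))) := by gcongr
      _ = _ := by ring
  · rw [tsum_mul_left]
    calc _ ≤ 2 * L * y ^ 2 * eulerConst j := by gcongr
      _ = _ := by ring

theorem exists_hasDerivAt_eulerSeries (j : ℕ) {y : ℝ} (hy : |y| * L < 1 / 2) :
    ∃ D, HasDerivAt (eulerSeries d j) D y ∧ y * D = eulerSeries d (j + 1) y := by
  have hball : ∀ z, z ∈ Metric.ball (0 : ℝ) (1 / (2 * L)) ↔ |z| * L < 1 / 2 := by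
    intro z
    rw [mem_ball_zero_iff, Real.norm_eq_abs, lt_div_iff₀ (by positivity)]
    constructor <;> intro h <;> linarith
  refine ⟨∑' m : ℕ, ((m : ℝ) + 1) ^ (j + 1) * d m * y ^ m, ?_, ?_⟩
  · refine hasDerivAt_tsum_of_isPreconnected
      (g := fun (m : ℕ) z => ((m : ℝ) + 1) ^ j * d m * z ^ (m + 1))
      (g' := fun (m : ℕ) z => ((m : ℝ) + 1) ^ (j + 1) * d m * z ^ m) (summable_eulerConst (j + 1))
      (t := Metric.ball (0 : ℝ) (1 / (2 * L))) (y₀ := y) Metric.isOpen_ball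
      (convex_ball _ _).isPreconnected (fun m z hz => ?_) (fun m z hz => ?_) ((hball y).2 hy)
      (summable_eulerSeries hL hd j hy.le) ((hball y).2 hy)
    · have h := (hasDerivAt_pow (m + 1) z).const_mul (((m : ℝ) + 1) ^ j * d m)
      refine h.congr_deriv ?_
      rw [Nat.add_sub_cancel]
      push_cast
      ring
    · have h := abs_mul_pow_le hL hd ((hball z).1 hz).le m
      have hm : |(m : ℝ) + 1| = m + 1 := abs_of_pos (by positivity)
      rw [Real.norm_eq_abs, abs_mul, abs_mul, abs_pow, abs_pow, hm, mul_assoc]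
      gcongr
  · rw [eulerSeries, ← tsum_mul_left]
    exact tsum_congr fun m => by ring

theorem eulerSeries_mul (i j : ℕ) {y : ℝ} (hy : |y| * L ≤ 1 / 2) :
    HasSum (fun n : ℕ => (∑ p ∈ antidiagonal n,
      ((p.1 : ℝ) + 1) ^ i * ((p.2 : ℝ) + 1) ^ j * d p.1 * d p.2) * y ^ (n + 2))
      (eulerSeries d i y * eulerSeries d j y) := by
  have hi := summable_norm_eulerSeries hL hd i hy
  have hj := summable_norm_eulerSeries hL hd j hy
  have hs := (summable_norm_sum_mul_antidiagonal_of_summable_norm hi hj).of_norm.hasSum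
  rw [← tsum_mul_tsum_eq_tsum_sum_antidiagonal_of_summable_norm hi hj] at hs
  refine hs.congr_fun fun n => ?_
  rw [Finset.sum_mul]
  refine Finset.sum_congr rfl fun p hp => ?_
  rw [← mem_antidiagonal.1 hp]
  ring

/-- If the coefficients satisfy the quadratic recurrence below, then the associated Euler series
solve the corresponding quadratic differential equation. -/
theorem eulerSeries_quadratic_ode {b μ : ℝ} (hb : b * μ ^ 2 + μ = b)
    (hrec : ∀ n : ℕ, (b * μ ^ 2 * ((n : ℝ) + 2) ^ 2 + μ * ((n : ℝ) + 2) - b) * d (n + 1) =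
      ∑ p ∈ antidiagonal n,
        (μ ^ 2 * (((p.1 : ℝ) + 1) * ((p.2 : ℝ) + 1) + ((p.2 : ℝ) + 1) ^ 2) - 1 / 2)
          * d p.1 * d p.2) {y : ℝ} (hy : |y| * L ≤ 1 / 2) :
    b * μ ^ 2 * eulerSeries d 2 y + μ * eulerSeries d 1 y - b * eulerSeries d 0 y =
      μ ^ 2 * (eulerSeries d 1 y * eulerSeries d 1 y + eulerSeries d 0 y * eulerSeries d 2 y)
        - 1 / 2 * (eulerSeries d 0 y * eulerSeries d 0 y) := by
  have hq := (((eulerSeries_mul hL hd 1 1 hy).add (eulerSeries_mul hL hd 0 2 hy)).mul_left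
    (μ ^ 2)).sub ((eulerSeries_mul hL hd 0 0 hy).mul_left (1 / 2))
  have hl := (((summable_eulerSeries hL hd 2 hy).hasSum.mul_left (b * μ ^ 2)).add
    ((summable_eulerSeries hL hd 1 hy).hasSum.mul_left μ)).sub
    ((summable_eulerSeries hL hd 0 hy).hasSum.mul_left b)
  have hl' := (hasSum_nat_add_iff' 1).2 hl
  have hz : ∑ i ∈ Finset.range 1, (b * μ ^ 2 * (((i : ℝ) + 1) ^ 2 * d i * y ^ (i + 1)) +
      μ * (((i : ℝ) + 1) ^ 1 * d i * y ^ (i + 1)) - b * (((i : ℝ) + 1) ^ 0 * d i * y ^ (i + 1)))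
      = 0 := by
    simp only [Finset.sum_range_one, Nat.cast_zero]
    linear_combination (d 0 * y) * hb
  rw [hz, sub_zero] at hl'
  refine hl'.unique ?_
  refine hq.congr_fun fun n => ?_
  have h := hrec n
  trans (∑ p ∈ antidiagonal n, (μ ^ 2 * (((p.1 : ℝ) + 1) * ((p.2 : ℝ) + 1) + ((p.2 : ℝ) + 1) ^ 2)
        - 1 / 2) * d p.1 * d p.2) * y ^ (n + 2)
  · rw [← h]; push_cast; ring
  · simp only [Finset.sum_mul, ← Finset.sum_add_distrib, Finset.mul_sum,
      ← Finset.sum_sub_distrib]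
    exact Finset.sum_congr rfl fun p _ => by ring

end

/-- Coefficients of the stationary profile written as a power series in `e ^ (-μ x)`. -/
theorem exists_profile_coefficients {b μ : ℝ} (hb0 : 0 < b) (hμ : 0 < μ)
    (hb : b * μ ^ 2 + μ = b) :
    ∃ (d : ℕ → ℝ) (L : ℝ), 0 < L ∧ d 0 = 1 ∧ (∀ n, |d n| ≤ L ^ n) ∧
      ∀ n : ℕ, (b * μ ^ 2 * ((n : ℝ) + 2) ^ 2 + μ * ((n : ℝ) + 2) - b) * d (n + 1) =
        ∑ p ∈ antidiagonal n,
          (μ ^ 2 * (((p.1 : ℝ) + 1) * ((p.2 : ℝ) + 1) + ((p.2 : ℝ) + 1) ^ 2) - 1 / 2)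
            * d p.1 * d p.2 := by
  have hden : ∀ n : ℝ, 0 ≤ n →
      b * μ ^ 2 * (n + 2) ^ 2 / 2 ≤ b * μ ^ 2 * (n + 2) ^ 2 + μ * (n + 2) - b := by
    intro n hn
    have : 0 < b * μ ^ 2 := by positivity
    nlinarith [mul_nonneg this.le hn, mul_nonneg (mul_nonneg this.le hn) hn,
      mul_nonneg hμ.le hn]
  obtain ⟨d, h0, hs, hd⟩ := exists_quadratic_recurrence (fun i j : ℕ =>
    (μ ^ 2 * (((i : ℝ) + 1) * ((j : ℝ) + 1) + ((j : ℝ) + 1) ^ 2) - 1 / 2) /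
      (b * μ ^ 2 * ((i : ℝ) + j + 2) ^ 2 + μ * ((i : ℝ) + j + 2) - b))
    (K := 2 * (μ ^ 2 + 1) / (b * μ ^ 2)) (by positivity) (by
      intro i j
      have h1 := hden ((i : ℝ) + j) (by positivity)
      have hi : (0 : ℝ) ≤ i := i.cast_nonneg
      have hj : (0 : ℝ) ≤ j := j.cast_nonneg
      have h2 : 0 < b * μ ^ 2 * ((i : ℝ) + j + 2) ^ 2 / 2 := by positivity
      have h3 : |μ ^ 2 * (((i : ℝ) + 1) * ((j : ℝ) + 1) + ((j : ℝ) + 1) ^ 2) - 1 / 2| ≤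
          (μ ^ 2 + 1) * ((i : ℝ) + j + 2) ^ 2 := by
        have h4 : ((i : ℝ) + 1) * ((j : ℝ) + 1) + ((j : ℝ) + 1) ^ 2 ≤ ((i : ℝ) + j + 2) ^ 2 := by
          nlinarith [mul_nonneg hi hj]
        have h5 := mul_le_mul_of_nonneg_left h4 (sq_nonneg μ)
        have h6 : 0 ≤ μ ^ 2 * (((i : ℝ) + 1) * ((j : ℝ) + 1) + ((j : ℝ) + 1) ^ 2) := by positivity
        rw [abs_le]
        constructor <;> nlinarith [mul_nonneg hi hj]
      rw [abs_div, abs_of_pos (h2.trans_le h1)]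
      calc _ ≤ (μ ^ 2 + 1) * ((i : ℝ) + j + 2) ^ 2 / (b * μ ^ 2 * ((i : ℝ) + j + 2) ^ 2 / 2) := by
            gcongr
        _ = _ := by field_simp)
  refine ⟨d, _, by positivity, h0, hd, fun n => ?_⟩
  have h1 := hden n n.cast_nonneg
  have h2 : 0 < b * μ ^ 2 * ((n : ℝ) + 2) ^ 2 / 2 := by positivity
  rw [hs, Finset.mul_sum]
  refine Finset.sum_congr rfl fun p hp => ?_
  have hp' : (p.1 : ℝ) + p.2 = n := by exact_mod_cast mem_antidiagonal.1 hp
  rw [hp']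
  rw [← mul_assoc, ← mul_assoc, mul_div_cancel₀ _ (h2.trans_le h1).ne']


/-- Non-degenerate case `u₋ < uplus < 0`: existence of a stationary
solution `(ū, q̄)` of `ū ū' + q̄' = 0`, `-q̄'' + q̄ + ū' = 0` on the half line with
`ū(0) = u₋`, `ū(+∞) = uplus`, `q̄(+∞) = 0`, `ū' > 0`, and exponential decay estimates
`|∂ₓᵏ(ū - uplus)| ≤ C δ e^{-λ x}` for `k = 0,1,2,3`, `|ū''²/ū'| ≤ Cδ`, `|ū'''²/ū'| ≤ Cδ`,
where `δ = uplus - u₋`. -/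
theorem stmt_14 (uplus : ℝ) (hu : uplus < 0) :
    ∃ δstar C lam : ℝ, 0 < δstar ∧ 0 < C ∧ 0 < lam ∧
      ∀ uminus ∈ Set.Ioo (uplus - δstar) uplus,
        ∃ u q : ℝ → ℝ,
          (∀ x ∈ Set.Ici (0:ℝ),
            DifferentiableAt ℝ u x ∧ DifferentiableAt ℝ (deriv u) x ∧
            DifferentiableAt ℝ (deriv (deriv u)) x ∧
            DifferentiableAt ℝ q x ∧ DifferentiableAt ℝ (deriv q) x) ∧
          (∀ x ∈ Set.Ioi (0:ℝ),
            u x * deriv u x + deriv q x = 0 ∧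
            -(deriv (deriv q) x) + q x + deriv u x = 0) ∧
          u 0 = uminus ∧
          Filter.Tendsto u Filter.atTop (nhds uplus) ∧
          Filter.Tendsto q Filter.atTop (nhds 0) ∧
          (∀ x ∈ Set.Ici (0:ℝ),
            0 < deriv u x ∧
            (∀ k ∈ Finset.Icc 0 3,
              |deriv^[k] (fun y => u y - uplus) x| ≤
                C * (uplus - uminus) * Real.exp (-lam * x)) ∧
            |(deriv (deriv u) x) ^ 2 / deriv u x| ≤ C * (uplus - uminus) ∧
            |(deriv (deriv (deriv u)) x) ^ 2 / deriv u x| ≤ C * (uplus - uminus)) := by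
  obtain ⟨b, rfl⟩ : ∃ b, uplus = -b := ⟨-uplus, by ring⟩
  have hb0 : 0 < b := by linarith
  obtain ⟨μ, hμ, hb⟩ : ∃ μ : ℝ, 0 < μ ∧ b * μ ^ 2 + μ = b := by
    have h := Real.sq_sqrt (show (0 : ℝ) ≤ 1 + 4 * b ^ 2 by positivity)
    have h1 : 1 < √(1 + 4 * b ^ 2) := Real.lt_sqrt_of_sq_lt (by nlinarith)
    refine ⟨(√(1 + 4 * b ^ 2) - 1) / (2 * b), div_pos (by linarith) (by linarith), ?_⟩
    set t := √(1 + 4 * b ^ 2)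
    field_simp
    linear_combination h
  obtain ⟨d, L, hL, hd0, hd, hrec⟩ := exists_profile_coefficients hb0 hμ hb
  let A := eulerConst
  have hA : ∀ j, 0 < A j := eulerConst_pos
  -- On `[-r, 0]` the profile and its Euler derivative are comparable to the identity.
  obtain ⟨r, hr, hrL, hr0, hr1⟩ : ∃ r : ℝ, 0 < r ∧ r * L < 1 / 2 ∧
      2 * L * A 0 * r ≤ 1 / 2 ∧ 2 * L * A 1 * r ≤ 1 / 2 := by
    have h0 := hA 0
    have h1 := hA 1
    refine ⟨1 / (4 * L * (1 + A 0 + A 1)), by positivity, ?_, ?_, ?_⟩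
    · rw [div_mul_eq_mul_div, div_lt_div_iff₀ (by positivity) (by positivity)]
      nlinarith [mul_pos hL h0, mul_pos hL h1]
    · rw [mul_one_div, div_le_div_iff₀ (by positivity) (by positivity)]
      nlinarith [mul_pos hL h0, mul_pos hL h1]
    · rw [mul_one_div, div_le_div_iff₀ (by positivity) (by positivity)]
      nlinarith [mul_pos hL h0, mul_pos hL h1]
  have hupper : ∀ j, 2 * L * A j * r ≤ 1 / 2 → ∀ y ∈ Set.Icc (-r) 0,
      eulerSeries d j y ≤ y / 2 := by
    intro j hj y hy
    have hy' : |y| * L ≤ 1 / 2 := by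
      rw [abs_of_nonpos hy.2]; nlinarith [hy.1]
    have h := (abs_le.1 (abs_eulerSeries_sub_le hL hd hd0 j hy')).2
    have h2 : 2 * L * eulerConst j * y ^ 2 ≤ -y / 2 := by
      have h3 : y ^ 2 ≤ r * -y := by nlinarith [hy.1, hy.2]
      calc 2 * L * eulerConst j * y ^ 2 ≤ 2 * L * eulerConst j * (r * -y) :=
            mul_le_mul_of_nonneg_left h3 (by have := hA j; positivity)
        _ = (2 * L * A j * r) * -y := by ring
        _ ≤ 1 / 2 * -y := mul_le_mul_of_nonneg_right hj (by linarith [hy.2])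
        _ = _ := by ring
    linarith
  let C := 2 * A 0 + 2 * μ * A 1 + 2 * μ ^ 2 * A 2 + 2 * μ ^ 3 * A 3 +
    4 * μ ^ 3 * A 2 ^ 2 + 4 * μ ^ 5 * A 3 ^ 2
  have hA0 := hA 0
  have hA1 := hA 1
  have hA2 := hA 2
  have hA3 := hA 3
  refine ⟨r / 2, C, μ, by positivity, by positivity, hμ, fun uminus hum => ?_⟩
  obtain ⟨s, hs, hsu⟩ : ∃ s ∈ Set.Ioo (-r) 0, eulerSeries d 0 s = uminus + b := by
    have hcont : ContinuousOn (eulerSeries d 0) (Set.Icc (-r) 0) := by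
      intro y hy
      have hy' : |y| * L < 1 / 2 := by
        rw [abs_of_nonpos hy.2]; nlinarith [hy.1]
      obtain ⟨D, hD, -⟩ := exists_hasDerivAt_eulerSeries hL hd 0 hy'
      exact hD.continuousAt.continuousWithinAt
    have h1 := hupper 0 hr0 (-r) ⟨le_rfl, by linarith⟩
    have h2 : eulerSeries d 0 0 = 0 := by simp [eulerSeries]
    refine intermediate_value_Ioo (by linarith) hcont ⟨?_, ?_⟩
    · linarith [hum.1]
    · linarith [hum.2]
  set δ := -b - uminus with hδ
  have hsδ : -s ≤ 2 * δ := by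
    have := hupper 0 hr0 s ⟨hs.1.le, hs.2.le⟩
    linarith
  let Y : ℝ → ℝ := fun x => s * Real.exp (-μ * x)
  let G : ℕ → ℝ → ℝ := fun j x => eulerSeries d j (Y x)
  have hYd : ∀ x, HasDerivAt Y (-μ * Y x) x := by
    intro x
    have h := (((hasDerivAt_id x).const_mul (-μ)).exp).const_mul s
    refine h.congr_deriv ?_
    simp only [Y, id]; ring
  let U : Set ℝ := {x | |Y x| * L < 1 / 2}
  have hU : IsOpen U := isOpen_lt (by fun_prop) continuous_const
  have hY : ∀ x, 0 ≤ x → Y x ∈ Set.Ico s 0 := by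
    intro x hx
    have h1 : Real.exp (-μ * x) ≤ 1 := Real.exp_le_one_iff.2 (by nlinarith)
    have h2 := Real.exp_pos (-μ * x)
    constructor <;> simp only [Y] <;> nlinarith [hs.2]
  have hYU : ∀ x, 0 ≤ x → x ∈ U := by
    intro x hx
    have h := hY x hx
    change |Y x| * L < 1 / 2
    rw [abs_of_neg h.2]
    nlinarith [h.1, hs.1]
  have hG : ∀ j, ∀ x ∈ U, HasDerivAt (G j) (-μ * G (j + 1) x) x := by
    intro j x hx
    obtain ⟨D, hD, hD'⟩ := exists_hasDerivAt_eulerSeries hL hd j hx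
    have h := hD.comp x (hYd x)
    refine h.congr_deriv ?_
    simp only [G]
    rw [← hD']; ring
  let u : ℝ → ℝ := fun x => -b + G 0 x
  let q : ℝ → ℝ := fun x => b * G 0 x - G 0 x ^ 2 / 2
  have hlift : ∀ {f g h : ℝ → ℝ}, (∀ x ∈ U, deriv f x = g x) →
      (∀ x ∈ U, HasDerivAt g (h x) x) → ∀ x ∈ U, HasDerivAt (deriv f) (h x) x := by
    intro f g h hfg hgh x hx
    exact (hgh x hx).congr_of_eventuallyEq
      (Filter.eventuallyEq_of_mem (hU.mem_nhds hx) hfg)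
  have hu1 : ∀ x ∈ U, HasDerivAt u (-μ * G 1 x) x := fun x hx => (hG 0 x hx).const_add _
  have hu2 : ∀ x ∈ U, HasDerivAt (deriv u) (μ ^ 2 * G 2 x) x :=
    hlift (fun x hx => (hu1 x hx).deriv) fun x hx => by
      exact ((hG 1 x hx).const_mul (-μ)).congr_deriv (by ring)
  have hu3 : ∀ x ∈ U, HasDerivAt (deriv (deriv u)) (-μ ^ 3 * G 3 x) x :=
    hlift (fun x hx => (hu2 x hx).deriv) fun x hx => by
      exact ((hG 2 x hx).const_mul (μ ^ 2)).congr_deriv (by ring)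
  have hq1 : ∀ x ∈ U, HasDerivAt q (-μ * (b * G 1 x - G 0 x * G 1 x)) x := fun x hx => by
    refine (((hG 0 x hx).const_mul b).sub (((hG 0 x hx).pow 2).div_const 2)).congr_deriv ?_
    push_cast; ring
  have hq2 : ∀ x ∈ U, HasDerivAt (deriv q)
      (μ ^ 2 * (b * G 2 x - (G 1 x * G 1 x + G 0 x * G 2 x))) x :=
    hlift (fun x hx => (hq1 x hx).deriv) fun x hx => by
      refine ((((hG 1 x hx).const_mul b).sub
        ((hG 0 x hx).mul (hG 1 x hx))).const_mul (-μ)).congr_deriv ?_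
      ring
  have hYlim : Filter.Tendsto Y Filter.atTop (nhds 0) := by
    have h : Filter.Tendsto (fun x : ℝ => Real.exp (-μ * x)) Filter.atTop (nhds 0) :=
      Real.tendsto_exp_atBot.comp (Filter.tendsto_id.const_mul_atTop_of_neg (by linarith))
    simpa only [mul_zero] using h.const_mul s
  have hG0lim : Filter.Tendsto (G 0) Filter.atTop (nhds 0) := by
    refine squeeze_zero_norm' (a := fun x => A 0 * |Y x|) ?_ ?_
    · filter_upwards [Filter.eventually_ge_atTop 0] with x hx
      exact abs_eulerSeries_le hL hd 0 (hYU x hx).le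
    · simpa using hYlim.abs.const_mul (A 0)
  refine ⟨u, q, fun x hx => ?_, fun x hx => ?_, ?_, ?_, ?_, fun x hx => ?_⟩
  · have hx' := hYU x hx
    exact ⟨(hu1 x hx').differentiableAt, (hu2 x hx').differentiableAt,
      (hu3 x hx').differentiableAt, (hq1 x hx').differentiableAt, (hq2 x hx').differentiableAt⟩
  · have hx' := hYU x (le_of_lt hx)
    rw [(hu1 x hx').deriv, (hq1 x hx').deriv, (hq2 x hx').deriv]
    refine ⟨by simp only [u]; ring, ?_⟩
    have h := eulerSeries_quadratic_ode hL hd hb hrec hx'.le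
    simp only [q, G]
    linear_combination -h
  · simp only [u, G, Y, mul_zero, Real.exp_zero, mul_one, hsu]; ring
  · simpa using hG0lim.const_add (-b)
  · simpa using (hG0lim.const_mul b).sub ((hG0lim.pow 2).div_const 2)
  · have hx' := hYU x hx
    have hYx := hY x hx
    have hYabs : |Y x| = -s * Real.exp (-μ * x) := by
      rw [abs_of_neg hYx.2]; simp only [Y]; ring
    have hYle : |Y x| ≤ 2 * δ * Real.exp (-μ * x) := by
      rw [hYabs]; gcongr
    have hYle' : |Y x| ≤ 2 * δ := by
      rw [abs_of_neg hYx.2]; linarith [hYx.1]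
    have hδ0 : 0 < δ := by linarith [hs.2]
    have hE : 0 ≤ δ * Real.exp (-μ * x) := by positivity
    have hGle : ∀ j, |G j x| ≤ A j * |Y x| := fun j => abs_eulerSeries_le hL hd j hx'.le
    have hG1 : |Y x| / 2 ≤ -G 1 x := by
      have := hupper 1 hr1 (Y x) ⟨by linarith [hYx.1, hs.1], hYx.2.le⟩
      rw [abs_of_neg hYx.2]
      simp only [G]; linarith
    have hYpos : 0 < |Y x| := abs_pos.2 hYx.2.ne
    have hd1 : μ * (|Y x| / 2) ≤ deriv u x := by
      rw [(hu1 x hx').deriv]; nlinarith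
    have hd1' : 0 < deriv u x := lt_of_lt_of_le (by positivity) hd1
    have hdecay : ∀ (j : ℕ) (c v : ℝ), 0 ≤ c → |v| ≤ c * |G j x| → 2 * c * A j ≤ C →
        |v| ≤ C * δ * Real.exp (-μ * x) := by
      intro j c v hc hv hC
      have hAj := hA j
      calc |v| ≤ c * (A j * (2 * δ * Real.exp (-μ * x))) := by
            refine hv.trans ?_
            gcongr
            exact (hGle j).trans (by gcongr)
        _ = (2 * c * A j) * (δ * Real.exp (-μ * x)) := by ring
        _ ≤ C * (δ * Real.exp (-μ * x)) := by gcongr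
        _ = _ := by ring
    have hquot : ∀ (j : ℕ) (c v : ℝ), 0 ≤ c → |v| ≤ c * |G j x| →
        4 * (c * A j) ^ 2 ≤ C * μ → |v ^ 2 / deriv u x| ≤ C * δ := by
      intro j c v hc hv hC
      have hAj := hA j
      have h1 : |v| ≤ c * A j * |Y x| := hv.trans (by
        rw [mul_assoc]; exact mul_le_mul_of_nonneg_left (hGle j) hc)
      rw [abs_of_nonneg (by positivity), div_le_iff₀ hd1', ← sq_abs]
      calc |v| ^ 2 ≤ (c * A j * |Y x|) ^ 2 := by gcongr
        _ = (c * A j) ^ 2 * |Y x| * |Y x| := by ring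
        _ ≤ (c * A j) ^ 2 * (2 * δ) * |Y x| := by gcongr
        _ = 4 * (c * A j) ^ 2 * (δ * |Y x| / 2) := by ring
        _ ≤ C * μ * (δ * |Y x| / 2) := by gcongr
        _ = C * δ * (μ * (|Y x| / 2)) := by ring
        _ ≤ C * δ * deriv u x := by gcongr
    have hv2 : |deriv (deriv u) x| ≤ μ ^ 2 * |G 2 x| := by
      rw [(hu2 x hx').deriv, abs_mul, abs_of_pos (by positivity)]
    have hv3 : |deriv (deriv (deriv u)) x| ≤ μ ^ 3 * |G 3 x| := by
      rw [(hu3 x hx').deriv, abs_mul, abs_neg, abs_of_pos (by positivity)]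
    have hC0 : 2 * 1 * A 0 ≤ C := by
      rw [← sub_nonneg]; simp only [C]; ring_nf; positivity
    have hC1 : 2 * μ * A 1 ≤ C := by
      rw [← sub_nonneg]; simp only [C]; ring_nf; positivity
    have hC2 : 2 * μ ^ 2 * A 2 ≤ C := by
      rw [← sub_nonneg]; simp only [C]; ring_nf; positivity
    have hC3 : 2 * μ ^ 3 * A 3 ≤ C := by
      rw [← sub_nonneg]; simp only [C]; ring_nf; positivity
    have hC4 : 4 * (μ ^ 2 * A 2) ^ 2 ≤ C * μ := by
      rw [← sub_nonneg]; simp only [C]; ring_nf; positivity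
    have hC5 : 4 * (μ ^ 3 * A 3) ^ 2 ≤ C * μ := by
      rw [← sub_nonneg]; simp only [C]; ring_nf; positivity
    refine ⟨hd1', fun k hk => ?_, hquot 2 _ _ (by positivity) hv2 hC4,
      hquot 3 _ _ (by positivity) hv3 hC5⟩
    have hderiv : deriv (fun y => u y - -b) = deriv u := by
      funext z; rw [deriv_sub_const]
    obtain ⟨-, hk3⟩ := Finset.mem_Icc.1 hk
    interval_cases k
    · refine hdecay 0 1 _ zero_le_one (le_of_eq ?_) hC0
      simp [u]
    · refine hdecay 1 μ _ hμ.le (le_of_eq ?_) hC1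
      rw [Function.iterate_one, hderiv, (hu1 x hx').deriv, abs_mul, abs_neg, abs_of_pos hμ]
    · refine hdecay 2 (μ ^ 2) _ (by positivity) ?_ hC2
      simpa only [Function.iterate_succ, Function.iterate_zero, Function.comp, id, hderiv] using hv2
    · refine hdecay 3 (μ ^ 3) _ (by positivity) ?_ hC3
      simpa only [Function.iterate_succ, Function.iterate_zero, Function.comp, id, hderiv] using hv3
end

section
/- Let u : ℝ → ℝ be twice differentiable with M₀ := sup_{x∈ℝ} |u(x)| < ∞ and M₂ := sup_{x∈ℝ} |u''(x)| < ∞. Then |u'(x)| ≤ √2 · M₀^{1/2} · M₂^{1/2} for every x ∈ ℝ. -/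
/-- Symmetric second-order Taylor bound: if `|u''| ≤ M`, then
`2 t u'(x) ≤ u (x + t) - u (x - t) + M t ^ 2` for `t ≥ 0`. -/
theorem two_mul_mul_deriv_le_of_abs_deriv_deriv_le {u : ℝ → ℝ}
    (hd1 : Differentiable ℝ u) (hd2 : Differentiable ℝ (deriv u)) {M : ℝ}
    (h₂ : ∀ x, |deriv (deriv u) x| ≤ M) (x : ℝ) {t : ℝ} (ht : 0 ≤ t) :
    2 * t * deriv u x ≤ u (x + t) - u (x - t) + M * t ^ 2 := by
  have lip (a b : ℝ) : |deriv u b - deriv u a| ≤ M * |b - a| := by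
    simpa [Real.norm_eq_abs] using
      convex_univ.norm_image_sub_le_of_norm_deriv_le (fun y _ => hd2 y)
        (fun y _ => h₂ y) (Set.mem_univ a) (Set.mem_univ b)
  have hg (s : ℝ) : HasDerivAt
      (fun s => u (x + s) - u (x - s) + M * s ^ 2 - 2 * s * deriv u x)
      (deriv u (x + s) + deriv u (x - s) + 2 * M * s - 2 * deriv u x) s := by
    have h1 := (hd1 (x + s)).hasDerivAt.comp_const_add x s
    have h2 := (hd1 (x - s)).hasDerivAt.comp_const_sub x s
    have h3 := (hasDerivAt_pow 2 s).const_mul M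
    have h4 := ((hasDerivAt_id' s).const_mul 2).mul_const (deriv u x)
    refine (((h1.sub h2).add h3).sub h4).congr_deriv ?_
    norm_num
    ring
  have mono := monotoneOn_of_deriv_nonneg (convex_Ici (0 : ℝ))
    (fun s _ => (hg s).continuousAt.continuousWithinAt)
    (fun s _ => (hg s).differentiableAt.differentiableWithinAt) (by
      intro s hs
      rw [interior_Ici, Set.mem_Ioi] at hs
      rw [(hg s).deriv]
      have h1 := lip x (x + s)
      have h2 := lip x (x - s)
      rw [add_sub_cancel_left, abs_of_pos hs] at h1
      rw [sub_sub_cancel_left, abs_neg, abs_of_pos hs] at h2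
      linarith [(abs_le.mp h1).1, (abs_le.mp h2).1])
  have h := mono Set.self_mem_Ici ht ht
  norm_num at h
  linarith

/-- Optimal Gagliardo–Nirenberg–Sobolev interpolation inequality on the
whole line: if `u` is twice differentiable with `|u| ≤ M₀` and `|u''| ≤ M₂` on `ℝ`, then
`|u'(x)| ≤ √2 √M₀ √M₂` for all `x`. -/
theorem stmt_15 (u : ℝ → ℝ)
    (hd1 : Differentiable ℝ u) (hd2 : Differentiable ℝ (deriv u))
    (M₀ M₂ : ℝ)
    (h₀ : ∀ x, |u x| ≤ M₀)
    (h₂ : ∀ x, |deriv (deriv u) x| ≤ M₂) :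
    ∀ x, |deriv u x| ≤ Real.sqrt 2 * Real.sqrt M₀ * Real.sqrt M₂ := by
  intro x
  have hM₀ : 0 ≤ M₀ := (abs_nonneg _).trans (h₀ 0)
  have hneg : deriv (-u) = -deriv u := deriv.neg'
  have hneg₂ : deriv (-deriv u) = -deriv (deriv u) := deriv.neg'
  have quad (t : ℝ) : 0 ≤ M₂ * (t * t) + (-2 * deriv u x) * t + 2 * M₀ := by
    have hp := abs_le.mp (h₀ (x + t))
    have hm := abs_le.mp (h₀ (x - t))
    rcases le_total 0 t with ht | ht
    · have := two_mul_mul_deriv_le_of_abs_deriv_deriv_le hd1 hd2 h₂ x ht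
      linarith
    · have := two_mul_mul_deriv_le_of_abs_deriv_deriv_le hd1.neg
        (by rw [hneg]; exact hd2.neg) (M := M₂)
        (by rw [hneg, hneg₂]; simpa using h₂) x (neg_nonneg.mpr ht)
      simp only [hneg, Pi.neg_apply, sub_neg_eq_add, ← sub_eq_add_neg] at this
      linarith
  have hdisc := discrim_le_zero quad
  rw [discrim] at hdisc
  rw [← Real.sqrt_mul zero_le_two, ← Real.sqrt_mul (by positivity)]
  exact Real.abs_le_sqrt (by linarith)
end

section
/- Let u : [0, ∞) → ℝ be twice differentiable on [0, ∞) (with one-sided derivatives at 0) with M₀ := sup_{x≥0} |u(x)| < ∞ and M₂ := sup_{x≥0} |u''(x)| < ∞. Then |u'(x)| ≤ 2 · M₀^{1/2} · M₂^{1/2} for every x ≥ 0. -/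
/-- Second-order Taylor bound on the half line for a function with bounded second derivative. -/
theorem abs_sub_taylor_le_of_abs_derivWithin_derivWithin_le {u : ℝ → ℝ}
    (hd1 : DifferentiableOn ℝ u (Set.Ici 0))
    (hd2 : DifferentiableOn ℝ (derivWithin u (Set.Ici 0)) (Set.Ici 0)) {M : ℝ}
    (hM : ∀ x ∈ Set.Ici (0 : ℝ),
      |derivWithin (derivWithin u (Set.Ici 0)) (Set.Ici 0) x| ≤ M)
    {x y : ℝ} (hx : 0 ≤ x) (hxy : x ≤ y) :
    |u y - u x - derivWithin u (Set.Ici 0) x * (y - x)| ≤ M / 2 * (y - x) ^ 2 := by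
  have hIci : ∀ t ∈ Set.Icc x y, t ∈ Set.Ici (0 : ℝ) := fun t ht => hx.trans ht.1
  have hlip : ∀ t ∈ Set.Ico x y,
      |derivWithin u (Set.Ici 0) t - derivWithin u (Set.Ici 0) x| ≤ M * (t - x) := by
    intro t ht
    have h := (convex_Ici (0 : ℝ)).norm_image_sub_le_of_norm_derivWithin_le hd2 hM
      (Set.mem_Ici.2 hx) (hIci t ⟨ht.1, ht.2.le⟩)
    rwa [Real.norm_eq_abs, Real.norm_eq_abs, abs_of_nonneg (sub_nonneg.2 ht.1)] at h
  have hcont : ContinuousOn (fun t => u t - u x - derivWithin u (Set.Ici 0) x * (t - x))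
      (Set.Icc x y) := by
    have := hd1.continuousOn.mono hIci
    fun_prop
  refine image_norm_le_of_norm_deriv_right_le_deriv_boundary hcont
    (f' := fun t => derivWithin u (Set.Ici 0) t - derivWithin u (Set.Ici 0) x)
    (B := fun t => M / 2 * (t - x) ^ 2) (B' := fun t => M * (t - x))
    (fun t ht => ?_) (by simp) (fun t => ?_) hlip (Set.right_mem_Icc.2 hxy)
  · have ht0 : 0 ≤ t := hx.trans ht.1
    have hu := ((hd1 t ht0).hasDerivWithinAt.mono (Set.Ici_subset_Ici.2 ht0)).sub_const (u x)
    exact (hu.sub (((hasDerivWithinAt_id t _).sub_const x).const_mul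
      (derivWithin u (Set.Ici 0) x))).congr_deriv (by rw [mul_one])
  · have h := (((hasDerivAt_id t).sub_const x).pow 2).const_mul (M / 2)
    exact h.congr_deriv (by simp; ring)


/-- Optimal Gagliardo–Nirenberg–Sobolev interpolation inequality on the
half line: if `u` is twice differentiable on `[0, ∞)` (one-sided derivatives at `0`) with
`|u| ≤ M₀` and `|u''| ≤ M₂` there, then `|u'(x)| ≤ 2 √M₀ √M₂` for all `x ≥ 0`. -/
theorem stmt_16 (u : ℝ → ℝ)
    (hd1 : ∀ x ∈ Set.Ici (0:ℝ), DifferentiableWithinAt ℝ u (Set.Ici 0) x)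
    (hd2 : ∀ x ∈ Set.Ici (0:ℝ),
      DifferentiableWithinAt ℝ (derivWithin u (Set.Ici 0)) (Set.Ici 0) x)
    (M₀ M₂ : ℝ)
    (h₀ : ∀ x ∈ Set.Ici (0:ℝ), |u x| ≤ M₀)
    (h₂ : ∀ x ∈ Set.Ici (0:ℝ),
      |derivWithin (derivWithin u (Set.Ici 0)) (Set.Ici 0) x| ≤ M₂) :
    ∀ x ∈ Set.Ici (0:ℝ),
      |derivWithin u (Set.Ici 0) x| ≤ 2 * Real.sqrt M₀ * Real.sqrt M₂ := by
  intro x hx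
  have hquad : ∀ h : ℝ,
      0 ≤ M₂ / 2 * (h * h) + -|derivWithin u (Set.Ici 0) x| * h + 2 * M₀ := by
    intro h
    have hM₀ : 0 ≤ M₀ := (abs_nonneg _).trans (h₀ x hx)
    have hM₂ : 0 ≤ M₂ := (abs_nonneg _).trans (h₂ x hx)
    rcases le_total h 0 with hh | hh
    · have := mul_nonneg (abs_nonneg (derivWithin u (Set.Ici 0) x)) (neg_nonneg.2 hh)
      have := mul_nonneg hM₂ (mul_self_nonneg h)
      linarith
    · have htaylor := abs_sub_taylor_le_of_abs_derivWithin_derivWithin_le hd1 hd2 h₂ hx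
        (le_add_of_nonneg_right hh)
      rw [add_sub_cancel_left] at htaylor
      have hx₀ := abs_le.1 (h₀ x hx)
      have hxh₀ := abs_le.1 (h₀ (x + h) (add_nonneg hx hh))
      have ht := abs_le.1 htaylor
      have : |derivWithin u (Set.Ici 0) x * h| ≤ M₂ / 2 * h ^ 2 + 2 * M₀ :=
        abs_le.2 ⟨by linarith, by linarith⟩
      rw [abs_mul, abs_of_nonneg hh] at this
      linarith
  have hdiscrim := discrim_le_zero hquad
  rw [discrim, neg_sq, sq_abs] at hdiscrim
  have hM₀ : 0 ≤ M₀ := (abs_nonneg _).trans (h₀ x hx)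
  have hM₂ : 0 ≤ M₂ := (abs_nonneg _).trans (h₂ x hx)
  refine abs_le_of_sq_le_sq ?_ (by positivity)
  rw [mul_pow, mul_pow, Real.sq_sqrt hM₀, Real.sq_sqrt hM₂]
  linarith
end

section
/- Let n ≥ 1 and let u : ℝⁿ → ℝ be twice differentiable with M₀ := sup_{x∈ℝⁿ} |u(x)| < ∞ and M₂ := sup_{x∈ℝⁿ} ‖D²u(x)‖ < ∞, where ‖D²u(x)‖ denotes the operator norm of the second derivative of u at x (a continuous symmetric bilinear form on ℝⁿ). Then |∇u(x)| ≤ √2 · M₀^{1/2} · M₂^{1/2} for every x ∈ ℝⁿ, where |∇u(x)| is the Euclidean norm of the gradient of u at x (equivalently, the operator norm of the Fréchet derivative). -/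
section Landau

variable {E : Type*} [NormedAddCommGroup E] [NormedSpace ℝ E] {u : E → ℝ} {M₀ M₂ : ℝ}

/-- Second-order bound for the symmetric difference of a function with bounded Hessian. -/
theorem two_mul_fderiv_le_sub_add_of_norm_fderiv_fderiv_le
    (hd1 : Differentiable ℝ u) (hd2 : Differentiable ℝ (fderiv ℝ u))
    (h₂ : ∀ x, ‖fderiv ℝ (fderiv ℝ u) x‖ ≤ M₂) (x h : E) :
    2 * fderiv ℝ u x h ≤ u (x + h) - u (x - h) + M₂ * ‖h‖ ^ 2 := by
  have lip (y : E) : ‖fderiv ℝ u y - fderiv ℝ u x‖ ≤ M₂ * ‖y - x‖ :=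
    convex_univ.norm_image_sub_le_of_norm_fderiv_le (fun z _ => hd2 z) (fun z _ => h₂ z)
      (Set.mem_univ x) (Set.mem_univ y)
  have lip_apply (s t : ℝ) (ht : 0 ≤ t) (hs : |s| = t) :
      -(M₂ * t * ‖h‖ ^ 2) ≤ fderiv ℝ u (x + s • h) h - fderiv ℝ u x h := by
    have key := (fderiv ℝ u (x + s • h) - fderiv ℝ u x).le_of_opNorm_le (lip _) h
    rw [add_sub_cancel_left, norm_smul, Real.norm_eq_abs, Real.norm_eq_abs, hs,
      sub_apply] at key
    linarith [neg_abs_le (fderiv ℝ u (x + s • h) h - fderiv ℝ u x h)]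
  let g : ℝ → ℝ := fun t =>
    u (x + t • h) - u (x + (-t) • h) - 2 * t * fderiv ℝ u x h + M₂ * t ^ 2 * ‖h‖ ^ 2
  have hg (t : ℝ) : HasDerivAt g (fderiv ℝ u (x + t • h) h + fderiv ℝ u (x + (-t) • h) h
      - 2 * fderiv ℝ u x h + 2 * M₂ * t * ‖h‖ ^ 2) t := by
    have hpos : HasDerivAt (fun t : ℝ => x + t • h) h t := by
      simpa using ((hasDerivAt_id t).smul_const h).const_add x
    have hneg : HasDerivAt (fun t : ℝ => x + (-t) • h) (-h) t := by
      simpa using ((hasDerivAt_id t).neg.smul_const h).const_add x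
    have hu₁ := (hd1 (x + t • h)).hasFDerivAt.comp_hasDerivAt t hpos
    have hu₂ := (hd1 (x + (-t) • h)).hasFDerivAt.comp_hasDerivAt t hneg
    have hlin := ((hasDerivAt_id t).const_mul 2).mul_const (fderiv ℝ u x h)
    have hsq := ((hasDerivAt_pow 2 t).const_mul M₂).mul_const (‖h‖ ^ 2)
    refine (((hu₁.sub hu₂).sub hlin).add hsq).congr_deriv ?_
    simp only [map_neg]
    push_cast
    ring
  have hmono : MonotoneOn g (Set.Ici 0) := by
    refine monotoneOn_of_deriv_nonneg (convex_Ici 0)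
      (fun t _ => (hg t).continuousAt.continuousWithinAt)
      (fun t _ => (hg t).differentiableAt.differentiableWithinAt) fun t ht => ?_
    rw [interior_Ici, Set.mem_Ioi] at ht
    rw [(hg t).deriv]
    linarith [lip_apply t t ht.le (abs_of_pos ht),
      lip_apply (-t) t ht.le (by rw [abs_neg, abs_of_pos ht])]
  have h01 := hmono (Set.mem_Ici.2 le_rfl) (Set.mem_Ici.2 zero_le_one) zero_le_one
  simp only [g, zero_smul, one_smul, neg_smul, ← sub_eq_add_neg] at h01
  norm_num at h01
  linarith

/-- Landau's inequality on a real normed space. -/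
theorem norm_fderiv_le_sqrt_two_mul_sqrt_mul_sqrt
    (hd1 : Differentiable ℝ u) (hd2 : Differentiable ℝ (fderiv ℝ u))
    (h₀ : ∀ x, |u x| ≤ M₀) (h₂ : ∀ x, ‖fderiv ℝ (fderiv ℝ u) x‖ ≤ M₂) (x : E) :
    ‖fderiv ℝ u x‖ ≤ √2 * √M₀ * √M₂ := by
  have hM₀ : 0 ≤ M₀ := (abs_nonneg _).trans (h₀ x)
  refine ContinuousLinearMap.opNorm_le_bound _ (by positivity) fun v => ?_
  have hquad (t : ℝ) :
      0 ≤ M₂ * ‖v‖ ^ 2 * (t * t) + -(2 * fderiv ℝ u x v) * t + 2 * M₀ := by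
    have key := two_mul_fderiv_le_sub_add_of_norm_fderiv_fderiv_le hd1 hd2 h₂ x (t • v)
    rw [map_smul, smul_eq_mul, norm_smul, mul_pow, Real.norm_eq_abs, sq_abs] at key
    linarith [(abs_le.1 (h₀ (x + t • v))).2, (abs_le.1 (h₀ (x - t • v))).1]
  have hdisc := discrim_le_zero hquad
  rw [discrim] at hdisc
  rw [← Real.sqrt_mul zero_le_two, ← Real.sqrt_mul (by positivity), Real.norm_eq_abs,
    ← Real.sqrt_sq (norm_nonneg v), ← Real.sqrt_mul' _ (sq_nonneg _)]
  exact Real.abs_le_sqrt (by linarith)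

end Landau


/-- Multi-dimensional optimal Gagliardo–Nirenberg–Sobolev interpolation
inequality: if `u : ℝⁿ → ℝ` is twice differentiable with `|u| ≤ M₀` and `‖D²u‖ ≤ M₂`
(operator norm of the Hessian) on `ℝⁿ`, then `|∇u(x)| ≤ √2 √M₀ √M₂` for all `x`, where
`|∇u(x)|` is the operator norm of the Fréchet derivative (the Euclidean norm of the
gradient). -/
theorem stmt_17 (n : ℕ) (hn : 1 ≤ n)
    (u : EuclideanSpace ℝ (Fin n) → ℝ)
    (hd1 : Differentiable ℝ u) (hd2 : Differentiable ℝ (fderiv ℝ u))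
    (M₀ M₂ : ℝ)
    (h₀ : ∀ x, |u x| ≤ M₀)
    (h₂ : ∀ x, ‖fderiv ℝ (fderiv ℝ u) x‖ ≤ M₂) :
    ∀ x, ‖fderiv ℝ u x‖ ≤ Real.sqrt 2 * Real.sqrt M₀ * Real.sqrt M₂ :=
  norm_fderiv_le_sqrt_two_mul_sqrt_mul_sqrt hd1 hd2 h₀ h₂
end

section
/- There exists a function u : ℝ → ℝ that is differentiable everywhere, whose derivative u' is Lipschitz continuous with Lipschitz constant 1, and which satisfies sup_{x∈ℝ} |u(x)| = 1/2 and sup_{x∈ℝ} |u'(x)| = 1. In particular, equality holds in the inequality sup|u'| ≤ √2 · (sup|u|)^{1/2} · L^{1/2} (where L is the Lipschitz constant of u'), so the constant √2 in the one-dimensional optimal Gagliardo–Nirenberg–Sobolev inequality on ℝ cannot be replaced by any smaller constant. -/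
theorem hasDerivAt_mul_abs (x : ℝ) : HasDerivAt (fun y : ℝ => y * |y|) (2 * |x|) x := by
  refine hasDerivAt_of_hasDerivAt_of_ne' (x := 0) (g := fun y : ℝ => 2 * |y|) ?_
    (by fun_prop) (by fun_prop) x
  intro y hy
  refine ((hasDerivAt_id' y).mul (hasDerivAt_abs hy)).congr_deriv ?_
  rw [mul_comm y, sign_mul_self]
  ring

/-- The primitive, odd in `x`, of the hat function `x ↦ max 0 (1 - |x|)`. -/
noncomputable def hatPrimitive (x : ℝ) : ℝ :=
  ((x + 1) * |x + 1| + (x - 1) * |x - 1| - 2 * (x * |x|)) / 4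

theorem hasDerivAt_hatPrimitive (x : ℝ) : HasDerivAt hatPrimitive (max 0 (1 - |x|)) x := by
  have h₁ := (hasDerivAt_mul_abs (x + 1)).comp_add_const x 1
  have h₂ := (hasDerivAt_mul_abs (x - 1)).comp_sub_const x 1
  refine (((h₁.add h₂).sub ((hasDerivAt_mul_abs x).const_mul 2)).div_const 4).congr_deriv ?_
  grind

theorem deriv_hatPrimitive : deriv hatPrimitive = fun x => max 0 (1 - |x|) :=
  funext fun x => (hasDerivAt_hatPrimitive x).deriv

theorem abs_hatPrimitive_le (x : ℝ) : |hatPrimitive x| ≤ 1 / 2 := by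
  unfold hatPrimitive
  rw [abs_le]
  rcases abs_cases (x + 1) with ⟨h₁, _⟩ | ⟨h₁, _⟩ <;>
  rcases abs_cases (x - 1) with ⟨h₂, _⟩ | ⟨h₂, _⟩ <;>
  rcases abs_cases x with ⟨h₃, _⟩ | ⟨h₃, _⟩ <;>
  rw [h₁, h₂, h₃] <;> constructor <;> nlinarith

/-- Optimality of the constant `√2` in the one-dimensional
Gagliardo–Nirenberg–Sobolev inequality on `ℝ`: there is a differentiable function `u`
whose derivative is `1`-Lipschitz, with `sup |u| = 1/2` and `sup |u'| = 1`, so that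
equality holds in `sup |u'| ≤ √2 (sup |u|)^{1/2} L^{1/2}`. -/
theorem stmt_18 :
    ∃ u : ℝ → ℝ,
      Differentiable ℝ u ∧
      LipschitzWith 1 (deriv u) ∧
      IsLUB (Set.range fun x => |u x|) (1/2) ∧
      IsLUB (Set.range fun x => |deriv u x|) 1 := by
  refine ⟨hatPrimitive, fun x => (hasDerivAt_hatPrimitive x).differentiableAt, ?_, ?_, ?_⟩
  · rw [deriv_hatPrimitive]
    refine LipschitzWith.of_dist_le_mul fun x y => ?_
    rw [Real.dist_eq, Real.dist_eq, NNReal.coe_one, one_mul]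
    grind
  · refine IsGreatest.isLUB ⟨⟨1, ?_⟩, ?_⟩
    · norm_num [hatPrimitive]
    · rintro _ ⟨x, rfl⟩
      exact abs_hatPrimitive_le x
  · rw [deriv_hatPrimitive]
    refine IsGreatest.isLUB ⟨⟨0, by simp⟩, ?_⟩
    rintro _ ⟨x, rfl⟩
    grind
end
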